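/- Suppose that for all y₂ and φ one has (c₊^{(2)}(+∞,y₂,φ))^{-1} c₊^{(1)}(+∞,y₂,φ) = (c₊^{(2)}(−∞,y₂,φ))^{-1} c₊^{(1)}(−∞,y₂,φ). Then there exists a matrix-valued function Q₊(x,t) defined on closure(B_{2R})×closure(D⁺) such that Q₊(x,t) = (c₊^{(2)}(x,t))^{-1} c₊^{(1)}(x,t) whenever R<|x|≤2R and |t|≥1, and: (a₁) Q₊ is C^∞ on closure(B_{2R})×closure(D⁺); (b₁) for each fixed x, Q₊(x,t) is analytic in t on D⁺ including t=∞; (c₁) det Q₊(x,t)≠0 for all x∈closure(B_{2R}) and t∈closure(D⁺) including t=∞; (d₁) ζ(t)·∂Q₊/∂x = 0 for all x∈closure(B_{2R}) and |t|≥1. -/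

import Mathlib

noncomputable section

open MeasureTheory Filter Topology Complex Matrix

abbrev R2 : Type := EuclideanSpace ℝ (Fin 2)
abbrev Mat (m : ℕ) : Type := Matrix (Fin m) (Fin m) ℂ
abbrev Vec (m : ℕ) : Type := Fin m → ℂ

/-- the point (a,b) ∈ ℝ² -/
def mk2 (a b : ℝ) : R2 := (WithLp.equiv 2 (Fin 2 → ℝ)).symm ![a, b]
def e1 : R2 := mk2 1 0
def e2 : R2 := mk2 0 1

/-- partial derivative of a scalar function in direction v -/
def pdv (v : R2) (f : R2 → ℂ) (x : R2) : ℂ := fderiv ℝ f x v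

def zeta1 (t : ℂ) : ℂ := (t + t⁻¹) / 2
def zeta2 (t : ℂ) : ℂ := (t - t⁻¹) / (2 * Complex.I)

/-- z = x₁ + i x₂ -/
def zOf (x : R2) : ℂ := (x 0 : ℂ) + Complex.I * (x 1 : ℂ)

/-- the kernel denominator t(z−z′)+t⁻¹(z̄−z̄′) -/
def ker (t : ℂ) (x y : R2) : ℂ :=
  t * (zOf x - zOf y) + t⁻¹ * (starRingEnd ℂ) (zOf x - zOf y)

/-- ζ·∂c/∂x for a matrix-valued function, entrywise -/
def zDirM {m : ℕ} (z1 z2 : ℂ) (c : R2 → Mat m) (x : R2) : Mat m :=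
  Matrix.of fun i j => z1 * pdv e1 (fun y => c y i j) x + z2 * pdv e2 (fun y => c y i j) x

def zDirV {m : ℕ} (z1 z2 : ℂ) (u : R2 → Vec m) (x : R2) : Vec m :=
  fun i => z1 * pdv e1 (fun y => u y i) x + z2 * pdv e2 (fun y => u y i) x

/-- ∂/∂z̄ of a matrix-valued function -/
def dzbarM {m : ℕ} (c : R2 → Mat m) (x : R2) : Mat m :=
  Matrix.of fun i j =>
    (pdv e1 (fun y => c y i j) x + Complex.I * pdv e2 (fun y => c y i j) x) / 2

def dzbarV {m : ℕ} (u : R2 → Vec m) (x : R2) : Vec m :=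
  fun i => (pdv e1 (fun y => u y i) x + Complex.I * pdv e2 (fun y => u y i) x) / 2

def dzM {m : ℕ} (c : R2 → Mat m) (x : R2) : Mat m :=
  Matrix.of fun i j =>
    (pdv e1 (fun y => c y i j) x - Complex.I * pdv e2 (fun y => c y i j) x) / 2

/-- the operator Π(t), matrix-valued version -/
def PiTM {m : ℕ} (t : ℂ) (f : R2 → Mat m) (x : R2) : Mat m :=
  Matrix.of fun i j => (Real.pi : ℂ)⁻¹ * ∫ y : R2, f y i j / ker t x y

def PiTV {m : ℕ} (t : ℂ) (f : R2 → Vec m) (x : R2) : Vec m :=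
  fun i => (Real.pi : ℂ)⁻¹ * ∫ y : R2, f y i / ker t x y

/-- the Cauchy transform S -/
def CauchyM {m : ℕ} (f : R2 → Mat m) (x : R2) : Mat m :=
  Matrix.of fun i j => (Real.pi : ℂ)⁻¹ * ∫ y : R2, f y i j / (zOf x - zOf y)

def CauchyV {m : ℕ} (f : R2 → Vec m) (x : R2) : Vec m :=
  fun i => (Real.pi : ℂ)⁻¹ * ∫ y : R2, f y i / (zOf x - zOf y)

/-- the contour integral ∮_{|t|=ρ} F(t) dt -/
def circIntM {m : ℕ} (F : ℂ → Mat m) (ρ : ℝ) : Mat m :=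
  Matrix.of fun i j => ∫ φ in (0:ℝ)..(2*Real.pi),
    F ((ρ:ℂ) * Complex.exp (Complex.I * φ)) i j * (Complex.I * ρ * Complex.exp (Complex.I * φ))

def circIntV {m : ℕ} (F : ℂ → Vec m) (ρ : ℝ) : Vec m :=
  fun i => ∫ φ in (0:ℝ)..(2*Real.pi),
    F ((ρ:ℂ) * Complex.exp (Complex.I * φ)) i * (Complex.I * ρ * Complex.exp (Complex.I * φ))

def MatSmooth {m : ℕ} (c : R2 → Mat m) : Prop := ∀ i j, ContDiff ℝ (⊤ : ℕ∞) (fun x => c x i j)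

def SuppIn {m : ℕ} (A : R2 → Mat m) (R : ℝ) : Prop := ∀ x : R2, R ≤ ‖x‖ → A x = 0

/-- A(x,ζ) = ζ₁A₁(x)+ζ₂A₂(x)+A₀(x) -/
def Acomb {m : ℕ} (A0 A1 A2 : R2 → Mat m) (z1 z2 : ℂ) (x : R2) : Mat m :=
  z1 • A1 x + z2 • A2 x + A0 x

/-- c solves θ·∂c/∂x = M(x)c along every line in direction θ -/
def Transport {m : ℕ} (M : R2 → Mat m) (θ : R2) (c : R2 → Mat m) : Prop :=
  ∀ x : R2, ∀ i j, HasDerivAt (fun s : ℝ => c (x + s • θ) i j) ((M x * c x) i j) 0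

open Classical in
/-- extension at infinity: `extInf F L` equals `F (1/s)` for `s ≠ 0` and `L` at `s = 0`;
analyticity of this at `0` encodes analyticity of `F` at `t = ∞` with value `L`. -/
def extInf {m : ℕ} (F : ℂ → Mat m) (L : Mat m) (s : ℂ) : Mat m := if s = 0 then L else F s⁻¹

section

open scoped ContDiff Interval

/-- Smooth functions of `(x, ψ)` that are `2π`-periodic in `ψ` and compactly supported in `x`. -/
structure SmoothPeriodic (F : R2 × ℝ → ℂ) : Prop where
  smooth : ContDiff ℝ ∞ F
  periodic : ∀ x ψ, F (x, ψ + 2 * Real.pi) = F (x, ψ)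
  support : ∃ ρ : ℝ, ∀ x ψ, ρ < ‖x‖ → F (x, ψ) = 0

/-- The directional derivative of `F` in the direction `w`. -/
def dirDeriv (w : R2 × ℝ) (F : R2 × ℝ → ℂ) (p : R2 × ℝ) : ℂ := fderiv ℝ F p w

/-- The `k`-th Fourier coefficient of `F x` in the angular variable. -/
def angCoef (F : R2 × ℝ → ℂ) (k : ℤ) (x : R2) : ℂ :=
  (2 * Real.pi : ℂ)⁻¹ * ∫ ψ in (0 : ℝ)..(2 * Real.pi), Complex.exp (-(k * ψ * I)) * F (x, ψ)

namespace SmoothPeriodic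

variable {F : R2 × ℝ → ℂ}

lemma exists_norm_le (hF : SmoothPeriodic F) : ∃ C, 0 ≤ C ∧ ∀ p, ‖F p‖ ≤ C := by
  obtain ⟨ρ, hρ⟩ := hF.support
  have hK : IsCompact (Metric.closedBall (0 : R2) ρ ×ˢ Set.Icc (0 : ℝ) (2 * Real.pi)) :=
    (isCompact_closedBall _ _).prod isCompact_Icc
  obtain ⟨C, hC⟩ := hK.exists_bound_of_continuousOn hF.smooth.continuous.continuousOn
  refine ⟨max C 0, le_max_right _ _, ?_⟩
  rintro ⟨x, ψ⟩
  by_cases hx : ρ < ‖x‖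
  · simp [hρ x ψ hx]
  have hper : Function.Periodic (fun ψ => F (x, ψ)) (2 * Real.pi) := fun ψ => hF.periodic x ψ
  obtain ⟨y, hy, hxy⟩ := hper.exists_mem_Ico₀ Real.two_pi_pos ψ
  have hxy' : F (x, ψ) = F (x, y) := hxy
  rw [hxy']
  refine (hC _ ⟨?_, hy.1, hy.2.le⟩).trans (le_max_left _ _)
  simpa using not_lt.mp hx

lemma directional (hF : SmoothPeriodic F) (w : R2 × ℝ) : SmoothPeriodic (dirDeriv w F) where
  smooth := (hF.smooth.fderiv_right (m := ∞) (by simp)).clm_apply contDiff_const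
  periodic x ψ := by
    have h : (fun p : R2 × ℝ => F (p + (0, 2 * Real.pi))) = F := by
      ext ⟨y, s⟩
      simpa using hF.periodic y s
    have h2 := fderiv_comp_add_right (𝕜 := ℝ) (f := F) (x := (x, ψ)) (0, 2 * Real.pi)
    rw [h] at h2
    simp only [dirDeriv, h2, Prod.mk_add_mk, add_zero]
  support := by
    obtain ⟨ρ, hρ⟩ := hF.support
    refine ⟨ρ, fun x ψ hx => ?_⟩
    have h : F =ᶠ[𝓝 (x, ψ)] fun _ => 0 := by
      have : {p : R2 × ℝ | ρ < ‖p.1‖} ∈ 𝓝 (x, ψ) :=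
        (isOpen_lt continuous_const (by fun_prop)).mem_nhds hx
      filter_upwards [this] with p hp using hρ p.1 p.2 hp
    simp [dirDeriv, h.fderiv_eq]

lemma exp_mul (hF : SmoothPeriodic F) (n : ℤ) :
    SmoothPeriodic fun p => Complex.exp (n * p.2 * I) * F p where
  smooth := by
    have : ContDiff ℝ ∞ fun p : R2 × ℝ => Complex.exp (n * p.2 * I) := by
      have : ContDiff ℝ ∞ fun p : R2 × ℝ => (p.2 : ℂ) := ofRealCLM.contDiff.comp contDiff_snd
      fun_prop
    exact this.mul hF.smooth
  periodic x ψ := by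
    have : (n * ((ψ + 2 * Real.pi : ℝ) : ℂ) * I) = n * ψ * I + n * (2 * Real.pi * I) := by
      push_cast; ring
    simp only [hF.periodic, this, Complex.exp_periodic.int_mul n _]
  support := by
    obtain ⟨ρ, hρ⟩ := hF.support
    exact ⟨ρ, fun x ψ hx => by simp [hρ x ψ hx]⟩

lemma const_mul (hF : SmoothPeriodic F) (c : ℂ) : SmoothPeriodic fun p => c * F p where
  smooth := contDiff_const.mul hF.smooth
  periodic x ψ := by simp [hF.periodic]
  support := by
    obtain ⟨ρ, hρ⟩ := hF.support
    exact ⟨ρ, fun x ψ hx => by simp [hρ x ψ hx]⟩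

lemma add {G : R2 × ℝ → ℂ} (hF : SmoothPeriodic F) (hG : SmoothPeriodic G) :
    SmoothPeriodic fun p => F p + G p where
  smooth := hF.smooth.add hG.smooth
  periodic x ψ := by simp [hF.periodic, hG.periodic]
  support := by
    obtain ⟨ρ, hρ⟩ := hF.support
    obtain ⟨σ, hσ⟩ := hG.support
    refine ⟨max ρ σ, fun x ψ hx => ?_⟩
    simp [hρ x ψ ((le_max_left _ _).trans_lt hx), hσ x ψ ((le_max_right _ _).trans_lt hx)]

lemma norm_exp_mul (k : ℤ) (ψ : ℝ) : ‖Complex.exp (-(k * ψ * I))‖ = 1 := by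
  rw [show -((k : ℂ) * ψ * I) = ((-(k * ψ) : ℝ) : ℂ) * I by push_cast; ring]
  exact Complex.norm_exp_ofReal_mul_I _

lemma norm_angCoef_le {C : ℝ} (hC : ∀ p, ‖F p‖ ≤ C) (k : ℤ) (x : R2) : ‖angCoef F k x‖ ≤ C := by
  have h := intervalIntegral.norm_integral_le_of_norm_le_const (a := 0) (b := 2 * Real.pi)
    (f := fun ψ : ℝ => Complex.exp (-(k * ψ * I)) * F (x, ψ)) (C := C)
    (fun ψ _ => by rw [norm_mul, norm_exp_mul, one_mul]; exact hC _)
  have hpi := Real.two_pi_pos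
  rw [angCoef, norm_mul, norm_inv]
  have : ‖(2 * Real.pi : ℂ)‖ = 2 * Real.pi := by
    rw [show (2 * Real.pi : ℂ) = ((2 * Real.pi : ℝ) : ℂ) by push_cast; ring, Complex.norm_real,
      Real.norm_of_nonneg hpi.le]
  rw [this, inv_mul_le_iff₀ hpi]
  rw [sub_zero, abs_of_pos hpi] at h
  linarith

lemma continuous_exp (k : ℤ) : Continuous fun ψ : ℝ => Complex.exp (-(k * ψ * I)) := by fun_prop

lemma hasDerivAt_angle (hF : SmoothPeriodic F) (x : R2) (ψ : ℝ) :
    HasDerivAt (fun ψ => F (x, ψ)) (dirDeriv (0, 1) F (x, ψ)) ψ := by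
  have h1 := (hF.smooth.differentiable (by simp) (x, ψ)).hasFDerivAt
  exact h1.comp_hasDerivAt ψ ((hasDerivAt_const ψ x).prodMk (hasDerivAt_id ψ))

lemma hasFDerivAt_slice (hF : SmoothPeriodic F) (x : R2) (ψ : ℝ) :
    HasFDerivAt (fun y => F (y, ψ))
      ((fderiv ℝ F (x, ψ)).comp (ContinuousLinearMap.inl ℝ R2 ℝ)) x := by
  have h1 := (hF.smooth.differentiable (by simp) (x, ψ)).hasFDerivAt
  exact h1.comp x (hasFDerivAt_prodMk_left x ψ)

lemma continuous_slice (hF : SmoothPeriodic F) (x : R2) : Continuous fun ψ => F (x, ψ) :=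
  hF.smooth.continuous.comp (by fun_prop)

lemma angCoef_dirDeriv_angle (hF : SmoothPeriodic F) (k : ℤ) (x : R2) :
    angCoef (dirDeriv (0, 1) F) k x = k * I * angCoef F k x := by
  have hu : ∀ ψ : ℝ, HasDerivAt (fun ψ : ℝ => Complex.exp (-(k * ψ * I)))
      (-(k * I) * Complex.exp (-(k * ψ * I))) ψ := by
    intro ψ
    have h1 : HasDerivAt (fun ψ : ℝ => -((k : ℂ) * ψ * I)) (-(k * I)) ψ := by
      simpa using (((hasDerivAt_id ψ).ofReal_comp.const_mul (k : ℂ)).mul_const I).fun_neg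
    simpa [mul_comm] using h1.cexp
  have hF' := hF.directional (0, 1)
  have h := intervalIntegral.integral_mul_deriv_eq_deriv_mul (a := 0) (b := 2 * Real.pi)
    (fun ψ _ => hu ψ) (fun ψ _ => hF.hasDerivAt_angle x ψ)
    (((continuous_exp k).const_mul _).intervalIntegrable _ _)
    ((hF'.continuous_slice x).intervalIntegrable _ _)
  have hp : F (x, 2 * Real.pi) = F (x, 0) := by simpa using hF.periodic x 0
  have he : Complex.exp (-(k * ((2 * Real.pi : ℝ) : ℂ) * I)) = 1 := by
    rw [Complex.exp_eq_one_iff]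
    exact ⟨-k, by push_cast; ring⟩
  rw [he, hp] at h
  simp only [mul_assoc, intervalIntegral.integral_const_mul] at h
  simp only [angCoef, mul_assoc]
  rw [h]
  simp only [neg_mul, mul_assoc]
  simp
  ring

lemma exists_angCoef_bound (hF : SmoothPeriodic F) :
    ∃ C, 0 ≤ C ∧ ∀ (k : ℤ) x, (1 + (k : ℝ) ^ 2) * ‖angCoef F k x‖ ≤ C := by
  obtain ⟨C0, h0, hC0⟩ := hF.exists_norm_le
  have hF2 := (hF.directional (0, 1)).directional (0, 1)
  obtain ⟨C2, h2, hC2⟩ := hF2.exists_norm_le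
  refine ⟨C0 + C2, by positivity, fun k x => ?_⟩
  have a0 := norm_angCoef_le hC0 k x
  have a2 := norm_angCoef_le hC2 k x
  rw [(hF.directional (0, 1)).angCoef_dirDeriv_angle, hF.angCoef_dirDeriv_angle] at a2
  simp only [norm_mul, Complex.norm_I, mul_one, Complex.norm_intCast] at a2
  have : |(k : ℝ)| * (|(k : ℝ)| * ‖angCoef F k x‖) = (k : ℝ) ^ 2 * ‖angCoef F k x‖ := by
    rw [← mul_assoc, ← sq, sq_abs]
  linarith

lemma angCoef_exp_mul (n k : ℤ) (x : R2) :
    angCoef (fun p => Complex.exp (n * p.2 * I) * F p) k x = angCoef F (k - n) x := by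
  simp only [angCoef]
  congr 1
  refine intervalIntegral.integral_congr fun ψ _ => ?_
  rw [← mul_assoc, ← Complex.exp_add]
  congr 2
  push_cast; ring

lemma angCoef_const_mul (c : ℂ) (k : ℤ) (x : R2) :
    angCoef (fun p => c * F p) k x = c * angCoef F k x := by
  simp only [angCoef]
  rw [mul_left_comm, ← intervalIntegral.integral_const_mul c]
  congr 1
  refine intervalIntegral.integral_congr fun ψ _ => ?_
  ring

lemma angCoef_add {G : R2 × ℝ → ℂ} (hF : SmoothPeriodic F) (hG : SmoothPeriodic G) (k : ℤ)
    (x : R2) : angCoef (fun p => F p + G p) k x = angCoef F k x + angCoef G k x := by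
  simp only [angCoef, mul_add]
  rw [intervalIntegral.integral_add, mul_add]
  · exact ((continuous_exp k).mul (hF.continuous_slice x)).intervalIntegrable _ _
  · exact ((continuous_exp k).mul (hG.continuous_slice x)).intervalIntegrable _ _

/-- The complex-valued coordinate functional on the plane. -/
def coordCLM (i : Fin 2) : R2 →L[ℝ] ℂ := ofRealCLM.comp (EuclideanSpace.proj i : R2 →L[ℝ] ℝ)

@[simp] lemma coordCLM_apply (i : Fin 2) (v : R2) : coordCLM i v = (v i : ℂ) := rfl

lemma eq_e1_add_e2 (v : R2) : v = v 0 • e1 + v 1 • e2 := by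
  ext i
  fin_cases i <;> simp [e1, e2, mk2]

/-- The real-linear functional with values `a` at `e1` and `b` at `e2`. -/
def planeCLM (a b : ℂ) : R2 →L[ℝ] ℂ := a • coordCLM 0 + b • coordCLM 1

lemma planeCLM_e1 (a b : ℂ) : planeCLM a b e1 = a := by simp [planeCLM, e1, mk2]
lemma planeCLM_e2 (a b : ℂ) : planeCLM a b e2 = b := by simp [planeCLM, e2, mk2]

lemma eq_planeCLM (L : R2 →L[ℝ] ℂ) : L = planeCLM (L e1) (L e2) := by
  ext v
  conv_lhs => rw [eq_e1_add_e2 v]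
  simp [planeCLM, mul_comm]

lemma norm_planeCLM_le (a b : ℂ) : ‖planeCLM a b‖ ≤ ‖a‖ * ‖coordCLM 0‖ + ‖b‖ * ‖coordCLM 1‖ := by
  refine (norm_add_le _ _).trans (le_of_eq ?_)
  rw [norm_smul, norm_smul]

lemma hasFDerivAt_angCoef (hF : SmoothPeriodic F) (k : ℤ) (x : R2) :
    HasFDerivAt (angCoef F k)
      (planeCLM (angCoef (dirDeriv (e1, 0) F) k x)
        (angCoef (dirDeriv (e2, 0) F) k x)) x := by
  have h1 := hF.directional (e1, 0)
  have h2 := hF.directional (e2, 0)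
  obtain ⟨C1, _, hC1⟩ := h1.exists_norm_le
  obtain ⟨C2, _, hC2⟩ := h2.exists_norm_le
  have hcont : ∀ {G : R2 × ℝ → ℂ}, SmoothPeriodic G → ∀ y : R2,
      Continuous fun ψ : ℝ => Complex.exp (-(k * ψ * I)) * G (y, ψ) :=
    fun hG y => (continuous_exp k).mul (hG.continuous_slice y)
  have hcont' : ∀ y : R2, Continuous fun ψ : ℝ =>
      planeCLM (Complex.exp (-(k * ψ * I)) * dirDeriv (e1, 0) F (y, ψ))
        (Complex.exp (-(k * ψ * I)) * dirDeriv (e2, 0) F (y, ψ)) := by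
    intro y
    exact ((hcont h1 y).smul continuous_const).add ((hcont h2 y).smul continuous_const)
  have key := intervalIntegral.hasFDerivAt_integral_of_dominated_of_fderiv_le
    (μ := volume) (a := 0) (b := 2 * Real.pi) (x₀ := x) (s := Set.univ)
    (F := fun y (ψ : ℝ) => Complex.exp (-(k * ψ * I)) * F (y, ψ))
    (F' := fun y (ψ : ℝ) =>
      planeCLM (Complex.exp (-(k * ψ * I)) * dirDeriv (e1, 0) F (y, ψ))
        (Complex.exp (-(k * ψ * I)) * dirDeriv (e2, 0) F (y, ψ)))
    (bound := fun _ => C1 * ‖coordCLM 0‖ + C2 * ‖coordCLM 1‖)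
    univ_mem
    (Eventually.of_forall fun y => (hcont hF y).aestronglyMeasurable)
    ((hcont hF x).intervalIntegrable _ _)
    (hcont' x).aestronglyMeasurable
    (ae_of_all _ fun ψ _ y _ => by
      refine (norm_planeCLM_le _ _).trans ?_
      simp only [norm_mul, norm_exp_mul, one_mul]
      gcongr
      · exact hC1 _
      · exact hC2 _)
    (by simp)
    (ae_of_all _ fun ψ _ y _ => by
      have h := (hF.hasFDerivAt_slice y ψ).const_mul (Complex.exp (-(k * ψ * I)))
      rw [eq_planeCLM (Complex.exp _ • _)] at h
      exact h)
  have key2 := key.const_mul (2 * Real.pi : ℂ)⁻¹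
  refine key2.congr_fderiv ?_
  simp only [planeCLM]
  rw [intervalIntegral.integral_add, intervalIntegral.integral_smul_const,
    intervalIntegral.integral_smul_const, smul_add, smul_smul, smul_smul]
  · rfl
  · exact ((hcont h1 x).smul continuous_const).intervalIntegrable _ _
  · exact ((hcont h2 x).smul continuous_const).intervalIntegrable _ _

end SmoothPeriodic


/-- The power series in `s` whose coefficients are the nonnegative Fourier coefficients of `F`. -/
def angSeries (F : R2 × ℝ → ℂ) (p : R2 × ℂ) : ℂ := ∑' k : ℕ, angCoef F k p.1 * p.2 ^ k

/-- The operator `F ↦ -i e^{-iψ} ∂F/∂ψ`, which corresponds to differentiation of `angSeries`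
in the disc variable. -/
def angRaise (F : R2 × ℝ → ℂ) (p : R2 × ℝ) : ℂ :=
  Complex.exp ((-1 : ℤ) * p.2 * I) * (-I * dirDeriv (0, 1) F p)

/-- The product of the plane with the closed unit disc. -/
def planeDisc : Set (R2 × ℂ) := Set.univ ×ˢ Metric.closedBall 0 1

lemma mem_planeDisc {p : R2 × ℂ} : p ∈ planeDisc ↔ ‖p.2‖ ≤ 1 := by
  simp [planeDisc, Set.mem_prod]

lemma closure_univ_prod_ball :
    closure ((Set.univ : Set R2) ×ˢ Metric.ball (0 : ℂ) 1) = planeDisc := by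
  rw [closure_prod_eq, closure_univ, closure_ball _ one_ne_zero, planeDisc]

lemma convex_univ_prod_ball : Convex ℝ ((Set.univ : Set R2) ×ˢ Metric.ball (0 : ℂ) 1) :=
  convex_univ.prod (convex_ball _ _)

lemma isOpen_univ_prod_ball : IsOpen ((Set.univ : Set R2) ×ˢ Metric.ball (0 : ℂ) 1) :=
  isOpen_univ.prod Metric.isOpen_ball

lemma uniqueDiffOn_planeDisc : UniqueDiffOn ℝ planeDisc := by
  refine uniqueDiffOn_univ.prod (uniqueDiffOn_convex (convex_closedBall _ _) ?_)
  rw [interior_closedBall _ one_ne_zero]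
  exact ⟨0, by simp⟩

namespace SmoothPeriodic

variable {F : R2 × ℝ → ℂ}

lemma exists_summable_bound (hF : SmoothPeriodic F) :
    ∃ u : ℤ → ℝ, Summable u ∧ ∀ k x, ‖angCoef F k x‖ ≤ u k := by
  obtain ⟨C, hC0, hC⟩ := hF.exists_angCoef_bound
  refine ⟨fun k => C / (1 + (k : ℝ) ^ 2), ?_, fun k x => ?_⟩
  · have h := (Real.summable_one_div_int_pow.mpr one_lt_two).mul_left C
    refine Summable.of_norm_bounded_eventually h ?_
    filter_upwards [(Set.finite_singleton (0 : ℤ)).compl_mem_cofinite] with k hk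
    have hk' : (k : ℝ) ≠ 0 := by simpa using hk
    have : 0 < (k : ℝ) ^ 2 := by positivity
    rw [Real.norm_of_nonneg (by positivity), div_eq_mul_one_div]
    gcongr
    linarith
  · rw [le_div_iff₀ (by positivity), mul_comm]
    exact hC k x

lemma summable_norm_angCoef (hF : SmoothPeriodic F) (x : R2) :
    Summable fun k => ‖angCoef F k x‖ := by
  obtain ⟨u, hu, hb⟩ := hF.exists_summable_bound
  exact Summable.of_nonneg_of_le (fun _ => norm_nonneg _) (fun k => hb k x) hu

lemma norm_mul_pow_le {a s : ℂ} {u : ℝ} (ha : ‖a‖ ≤ u) (hs : ‖s‖ ≤ 1) (n : ℕ) :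
    ‖a * s ^ n‖ ≤ u := by
  rw [norm_mul, norm_pow]
  have h1 : ‖s‖ ^ n ≤ 1 := pow_le_one₀ (norm_nonneg _) hs
  nlinarith [norm_nonneg a, norm_nonneg s]

lemma hasSum_angSeries (hF : SmoothPeriodic F) {p : R2 × ℂ} (hp : p ∈ planeDisc) :
    HasSum (fun k : ℕ => angCoef F k p.1 * p.2 ^ k) (angSeries F p) := by
  obtain ⟨u, hu, hb⟩ := hF.exists_summable_bound
  exact (Summable.of_norm_bounded (hu.comp_injective Nat.cast_injective)
    fun k => norm_mul_pow_le (hb k p.1) (mem_planeDisc.mp hp) k).hasSum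

lemma continuous_angCoef (hF : SmoothPeriodic F) (k : ℤ) : Continuous (angCoef F k) :=
  continuous_iff_continuousAt.mpr fun x => (hF.hasFDerivAt_angCoef k x).continuousAt

lemma continuousOn_angSeries (hF : SmoothPeriodic F) : ContinuousOn (angSeries F) planeDisc := by
  obtain ⟨u, hu, hb⟩ := hF.exists_summable_bound
  refine continuousOn_tsum (u := fun k : ℕ => u k) (fun k => ?_)
    (hu.comp_injective Nat.cast_injective)
    fun k p hp => norm_mul_pow_le (hb k p.1) (mem_planeDisc.mp hp) k
  exact (((hF.continuous_angCoef k).comp continuous_fst).mul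
    (continuous_snd.pow k)).continuousOn

lemma raise (hF : SmoothPeriodic F) : SmoothPeriodic (angRaise F) :=
  ((hF.directional (0, 1)).const_mul (-I)).exp_mul (-1)

lemma angCoef_angRaise (hF : SmoothPeriodic F) (k : ℤ) (x : R2) :
    angCoef (angRaise F) k x = (k + 1) * angCoef F (k + 1) x := by
  have h := angCoef_exp_mul (F := fun p => -I * dirDeriv (0, 1) F p) (-1) k x
  rw [angCoef_const_mul, hF.angCoef_dirDeriv_angle, sub_neg_eq_add] at h
  refine h.trans ?_
  push_cast
  linear_combination (-(k + 1) * angCoef F (k + 1) x) * Complex.I_mul_I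

/-- The candidate for the derivative of `angSeries F`. -/
def _root_.angSeriesDeriv (F : R2 × ℝ → ℂ) (p : R2 × ℂ) : R2 × ℂ →L[ℝ] ℂ :=
  angSeries (dirDeriv (e1, 0) F) p • (coordCLM 0).comp (.fst ℝ R2 ℂ) +
  angSeries (dirDeriv (e2, 0) F) p • (coordCLM 1).comp (.fst ℝ R2 ℂ) +
  angSeries (angRaise F) p • .snd ℝ R2 ℂ

lemma hasFDerivAt_angSeries (hF : SmoothPeriodic F) {p : R2 × ℂ} (hp : ‖p.2‖ < 1) :
    HasFDerivAt (angSeries F) (angSeriesDeriv F p) p := by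
  have h1 := hF.directional (e1, 0)
  have h2 := hF.directional (e2, 0)
  have h3 := hF.raise
  obtain ⟨u1, hu1, hb1⟩ := h1.exists_summable_bound
  obtain ⟨u2, hu2, hb2⟩ := h2.exists_summable_bound
  obtain ⟨u3, hu3, hb3⟩ := h3.exists_summable_bound
  set P0 : R2 × ℂ →L[ℝ] ℂ := (coordCLM 0).comp (.fst ℝ R2 ℂ) with hP0
  set P1 : R2 × ℂ →L[ℝ] ℂ := (coordCLM 1).comp (.fst ℝ R2 ℂ) with hP1
  set P2 : R2 × ℂ →L[ℝ] ℂ := .snd ℝ R2 ℂ with hP2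
  let f' : ℕ → R2 × ℂ → (R2 × ℂ →L[ℝ] ℂ) := fun k q =>
    (angCoef (dirDeriv (e1, 0) F) k q.1 * q.2 ^ k) • P0 +
    (angCoef (dirDeriv (e2, 0) F) k q.1 * q.2 ^ k) • P1 +
    (angCoef (angRaise F) (k - 1) q.1 * q.2 ^ (k - 1)) • P2
  have hpS : p ∈ planeDisc := mem_planeDisc.mpr hp.le
  have hinj : Function.Injective fun k : ℕ => (k : ℤ) - 1 := fun a b h => by
    simpa using h
  have key := hasFDerivAt_tsum_of_isPreconnected (𝕜 := ℝ)
    (s := (Set.univ : Set R2) ×ˢ Metric.ball (0 : ℂ) 1)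
    (u := fun k : ℕ => u1 k * ‖P0‖ + u2 k * ‖P1‖ + u3 (k - 1) * ‖P2‖)
    (f := fun (k : ℕ) (q : R2 × ℂ) => angCoef F k q.1 * q.2 ^ k) (f' := f') (x₀ := p) (x := p)
    ((((hu1.comp_injective Nat.cast_injective).mul_right _).add
      ((hu2.comp_injective Nat.cast_injective).mul_right _)).add
      ((hu3.comp_injective hinj).mul_right _))
    isOpen_univ_prod_ball convex_univ_prod_ball.isPreconnected ?_ ?_ (by simpa using hp)
    (hF.hasSum_angSeries hpS).summable (by simpa using hp)
  · refine key.congr_fderiv (HasSum.tsum_eq ?_)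
    refine (((h1.hasSum_angSeries hpS).smul_const P0).add
      ((h2.hasSum_angSeries hpS).smul_const P1)).add ?_
    refine HasSum.smul_const ?_ P2
    rw [← hasSum_nat_add_iff' 1]
    simpa [hF.angCoef_angRaise] using h3.hasSum_angSeries hpS
  · intro k q _
    have hc := (hF.hasFDerivAt_angCoef k q.1).comp q
      (hasFDerivAt_fst (𝕜 := ℝ) (E := R2) (F := ℂ) (p := q))
    have hs : HasFDerivAt (fun q : R2 × ℂ => q.2 ^ k) ((k * q.2 ^ (k - 1)) • P2) q := by
      have := (hasFDerivAt_snd (𝕜 := ℝ) (E := R2) (F := ℂ) (p := q)).pow k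
      refine this.congr_fderiv ?_
      ext v <;> simp [hP2]
    refine (hc.mul hs).congr_fderiv ?_
    have := hF.angCoef_angRaise ((k : ℤ) - 1) q.1
    simp only [sub_add_cancel] at this
    push_cast at this
    simp only [sub_add_cancel] at this
    ext v <;> simp [f', this, planeCLM, P0, P1, P2] <;> ring
  · intro k q hq
    have hq' : ‖q.2‖ ≤ 1 := by simpa using (Set.mem_prod.mp hq).2.out.le
    refine (norm_add_le _ _).trans (add_le_add ((norm_add_le _ _).trans (add_le_add ?_ ?_)) ?_)
    all_goals rw [norm_smul]; gcongr
    · exact norm_mul_pow_le (hb1 k q.1) hq' k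
    · exact norm_mul_pow_le (hb2 k q.1) hq' k
    · exact norm_mul_pow_le (hb3 _ q.1) hq' _

lemma hasFDerivWithinAt_angSeries (hF : SmoothPeriodic F) {p : R2 × ℂ} (hp : p ∈ planeDisc) :
    HasFDerivWithinAt (angSeries F) (angSeriesDeriv F p) planeDisc p := by
  rw [← closure_univ_prod_ball]
  have hmem : ∀ {q : R2 × ℂ}, q ∈ (Set.univ : Set R2) ×ˢ Metric.ball (0 : ℂ) 1 → ‖q.2‖ < 1 :=
    fun hq => by simpa using hq
  refine hasFDerivWithinAt_closure_of_tendsto_fderiv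
    (fun q hq => (hF.hasFDerivAt_angSeries (hmem hq)).differentiableAt.differentiableWithinAt)
    convex_univ_prod_ball isOpen_univ_prod_ball (fun q hq => ?_) ?_
  · rw [closure_univ_prod_ball] at hq
    exact (hF.continuousOn_angSeries q hq).mono (closure_univ_prod_ball ▸ subset_closure)
  · have hc : ContinuousWithinAt (angSeriesDeriv F) planeDisc p := by
      have h1 := (hF.directional (e1, 0)).continuousOn_angSeries p hp
      have h2 := (hF.directional (e2, 0)).continuousOn_angSeries p hp
      have h3 := hF.raise.continuousOn_angSeries p hp
      exact ((h1.smul continuousWithinAt_const).add (h2.smul continuousWithinAt_const)).add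
        (h3.smul continuousWithinAt_const)
    have hc' := hc.mono (closure_univ_prod_ball ▸ subset_closure)
    refine Tendsto.congr' ?_ hc'
    filter_upwards [self_mem_nhdsWithin] with q hq
    exact (hF.hasFDerivAt_angSeries (hmem hq)).fderiv.symm

lemma contDiffOn_angSeries (hF : SmoothPeriodic F) : ContDiffOn ℝ ∞ (angSeries F) planeDisc := by
  rw [contDiffOn_infty]
  intro n
  induction n generalizing F with
  | zero => exact contDiffOn_zero.mpr hF.continuousOn_angSeries
  | succ n ih =>
    push_cast
    rw [contDiffOn_succ_iff_hasFDerivWithinAt_of_uniqueDiffOn uniqueDiffOn_planeDisc]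
    refine ⟨by simp, angSeriesDeriv F, ?_, fun p hp => hF.hasFDerivWithinAt_angSeries hp⟩
    exact (((ih (hF.directional (e1, 0))).smul contDiffOn_const).add
      ((ih (hF.directional (e2, 0))).smul contDiffOn_const)).add
      ((ih hF.raise).smul contDiffOn_const)

lemma hasFDerivAt_angSeries_fst (hF : SmoothPeriodic F) (x : R2) {s : ℂ} (hs : ‖s‖ ≤ 1) :
    HasFDerivAt (fun y => angSeries F (y, s))
      (planeCLM (angSeries (dirDeriv (e1, 0) F) (x, s))
        (angSeries (dirDeriv (e2, 0) F) (x, s))) x := by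
  have h := hF.hasFDerivWithinAt_angSeries (p := (x, s)) (mem_planeDisc.mpr hs)
  have h2 := h.comp x (s := Set.univ) (hasFDerivAt_prodMk_left (𝕜 := ℝ) x s).hasFDerivWithinAt
    (fun y _ => mem_planeDisc.mpr hs)
  rw [hasFDerivWithinAt_univ] at h2
  refine h2.congr_fderiv ?_
  ext v
  simp [angSeriesDeriv, planeCLM]

lemma diffContOnCl_angSeries (hF : SmoothPeriodic F) (x : R2) :
    DiffContOnCl ℂ (fun s => angSeries F (x, s)) (Metric.ball 0 1) := by
  obtain ⟨u, hu, hb⟩ := hF.exists_summable_bound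
  refine ⟨?_, ?_⟩
  · exact Complex.differentiableOn_tsum_of_summable_norm (u := fun k : ℕ => u k)
      (hu.comp_injective Nat.cast_injective)
      (fun k => ((differentiable_id.pow k).const_mul (angCoef F k x)).differentiableOn)
      Metric.isOpen_ball
      fun k s hs => norm_mul_pow_le (hb k x) (by simpa using (Metric.mem_ball.mp hs).le) k
  · rw [closure_ball _ one_ne_zero]
    exact hF.continuousOn_angSeries.comp (by fun_prop)
      fun s hs => mem_planeDisc.mpr (by simpa using hs)

end SmoothPeriodic


lemma integral_fderiv_mul_fderiv_comm {u v : R2 → ℂ} (hu : ContDiff ℝ ∞ u) (hv : ContDiff ℝ ∞ v)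
    (hu' : HasCompactSupport u) (a b : R2) :
    ∫ x, fderiv ℝ u x a * fderiv ℝ v x b = ∫ x, fderiv ℝ u x b * fderiv ℝ v x a := by
  have hdv : ∀ a, ContDiff ℝ ∞ fun x => fderiv ℝ v x a := fun a =>
    (hv.fderiv_right (m := ∞) (by simp)).clm_apply contDiff_const
  have hdu : ∀ a, Continuous fun x => fderiv ℝ u x a := fun a =>
    ((hu.fderiv_right (m := ∞) (by simp)).clm_apply contDiff_const).continuous
  have hdu' : ∀ a, HasCompactSupport fun x => fderiv ℝ u x a := fun a => hu'.fderiv_apply ℝ a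
  have key : ∀ a b, ∫ x, fderiv ℝ u x a * fderiv ℝ v x b
      = - ∫ x, u x * fderiv ℝ (fun y => fderiv ℝ v y b) x a := by
    intro a b
    rw [integral_mul_fderiv_eq_neg_fderiv_mul_of_integrable (f := u)
      (g := fun y => fderiv ℝ v y b), neg_neg]
    · exact ((hdu a).mul (hdv b).continuous).integrable_of_hasCompactSupport (hdu' a).mul_right
    · exact (hu.continuous.mul
        (((hdv b).continuous_fderiv (by simp)).clm_apply continuous_const)
        ).integrable_of_hasCompactSupport hu'.mul_right
    · exact (hu.continuous.mul (hdv b).continuous).integrable_of_hasCompactSupport hu'.mul_right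
    · exact fun x _ => hu.differentiable (by simp) x
    · exact fun x _ => (hdv b).differentiable (by simp) x
  rw [key a b, key b a]
  congr 2
  ext x
  have hsymm : IsSymmSndFDerivAt ℝ v x := (hv.contDiffAt).isSymmSndFDerivAt
    (by simp only [minSmoothness_of_isRCLikeNormedField]; exact ENat.LEInfty.out)
  have hd : ∀ a b, fderiv ℝ (fun y => fderiv ℝ v y b) x a = fderiv ℝ (fderiv ℝ v) x a b := by
    intro a b
    have h : DifferentiableAt ℝ (fderiv ℝ v) x :=
      (hv.fderiv_right (m := ∞) (by simp)).differentiable (by simp) x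
    rw [fderiv_clm_apply h (differentiableAt_const b)]
    simp
  rw [hd, hd, hsymm.eq a b]

/-- A compactly supported function has Wirtinger derivatives of equal `L²` norms. -/
lemma integral_sq_wirtinger {u : R2 → ℂ} (hu : ContDiff ℝ ∞ u) (hu' : HasCompactSupport u) :
    ∫ x, ‖fderiv ℝ u x e1 + I * fderiv ℝ u x e2‖ ^ 2 =
      ∫ x, ‖fderiv ℝ u x e1 - I * fderiv ℝ u x e2‖ ^ 2 := by
  set v : R2 → ℂ := fun x => (starRingEnd ℂ) (u x) with hvdef
  have hv : ContDiff ℝ ∞ v := conjCLE.contDiff.comp hu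
  have hdv : ∀ x a, fderiv ℝ v x a = (starRingEnd ℂ) (fderiv ℝ u x a) := by
    intro x a
    have h := (conjCLE.toContinuousLinearMap.hasFDerivAt (x := u x)).comp x
      (hu.differentiable (by simp) x).hasFDerivAt
    have h' : HasFDerivAt v _ x := h
    rw [h'.fderiv]
    rfl
  have hdu : ∀ a, Continuous fun x => fderiv ℝ u x a := fun a =>
    ((hu.fderiv_right (m := ∞) (by simp)).clm_apply contDiff_const).continuous
  have hdu' : ∀ a, HasCompactSupport fun x => fderiv ℝ u x a := fun a => hu'.fderiv_apply ℝ a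
  have hcs : ∀ c : ℂ, HasCompactSupport fun x => fderiv ℝ u x e1 + c * fderiv ℝ u x e2 :=
    fun c => (hdu' e1).add (hdu' e2).mul_left
  have hint : ∀ c : ℂ, Integrable fun x => ‖fderiv ℝ u x e1 + c * fderiv ℝ u x e2‖ ^ 2 := by
    intro c
    have hc : Continuous fun x => ‖fderiv ℝ u x e1 + c * fderiv ℝ u x e2‖ ^ 2 :=
      (((hdu e1).add ((hdu e2).const_mul c)).norm).pow 2
    refine hc.integrable_of_hasCompactSupport ?_
    exact (hcs c).comp_left (g := fun z : ℂ => ‖z‖ ^ 2) (by simp)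
  have hI := hint I
  have hI' := hint (-I)
  simp only [neg_mul, ← sub_eq_add_neg] at hI'
  rw [← sub_eq_zero, ← integral_sub hI hI']
  have hcomm := integral_fderiv_mul_fderiv_comm hu hv hu' e1 e2
  have hi12 : Integrable fun x => fderiv ℝ u x e1 * fderiv ℝ v x e2 := by
    simp only [hdv]
    exact ((hdu e1).mul (continuous_conj.comp (hdu e2))).integrable_of_hasCompactSupport
      (hdu' e1).mul_right
  have hi21 : Integrable fun x => fderiv ℝ u x e2 * fderiv ℝ v x e1 := by
    simp only [hdv]
    exact ((hdu e2).mul (continuous_conj.comp (hdu e1))).integrable_of_hasCompactSupport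
      (hdu' e2).mul_right
  rw [← sub_eq_zero, ← integral_sub hi12 hi21] at hcomm
  rw [← Complex.ofReal_eq_zero, ← integral_complex_ofReal]
  have hpt : ∀ x, ((‖fderiv ℝ u x e1 + I * fderiv ℝ u x e2‖ ^ 2
      - ‖fderiv ℝ u x e1 - I * fderiv ℝ u x e2‖ ^ 2 : ℝ) : ℂ) =
      (-2 * I) * (fderiv ℝ u x e1 * fderiv ℝ v x e2 - fderiv ℝ u x e2 * fderiv ℝ v x e1) := by
    intro x
    push_cast
    rw [← Complex.mul_conj', ← Complex.mul_conj', hdv, hdv]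
    simp only [map_add, map_sub, map_mul, Complex.conj_I]
    ring
  simp only [hpt]
  rw [integral_const_mul, hcomm, mul_zero]

namespace SmoothPeriodic

variable {F : R2 × ℝ → ℂ}

lemma fderiv_angCoef_e1 (hF : SmoothPeriodic F) (k : ℤ) (x : R2) :
    fderiv ℝ (angCoef F k) x e1 = angCoef (dirDeriv (e1, 0) F) k x := by
  rw [(hF.hasFDerivAt_angCoef k x).fderiv, planeCLM_e1]

lemma fderiv_angCoef_e2 (hF : SmoothPeriodic F) (k : ℤ) (x : R2) :
    fderiv ℝ (angCoef F k) x e2 = angCoef (dirDeriv (e2, 0) F) k x := by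
  rw [(hF.hasFDerivAt_angCoef k x).fderiv, planeCLM_e2]

lemma contDiff_angCoef (hF : SmoothPeriodic F) (k : ℤ) : ContDiff ℝ ∞ (angCoef F k) := by
  rw [contDiff_infty]
  intro n
  induction n generalizing F with
  | zero => exact contDiff_zero.mpr (hF.continuous_angCoef k)
  | succ n ih =>
    push_cast
    rw [contDiff_succ_iff_hasFDerivAt]
    exact ⟨_, ((ih (hF.directional (e1, 0))).smul contDiff_const).add
      ((ih (hF.directional (e2, 0))).smul contDiff_const), hF.hasFDerivAt_angCoef k⟩

/-- If `F` is constant along lines of direction `(cos ψ, -sin ψ)` inside a disc and its negative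
Fourier coefficients vanish outside this disc, then they vanish everywhere. -/
lemma angCoef_eq_zero_of_neg (hF : SmoothPeriodic F) {R : ℝ}
    (hT : ∀ x ψ, ‖x‖ ≤ R →
      (dirDeriv (e1, 0) F (x, ψ) - I * dirDeriv (e2, 0) F (x, ψ)) + Complex.exp (2 * ψ * I) *
        (dirDeriv (e1, 0) F (x, ψ) + I * dirDeriv (e2, 0) F (x, ψ)) = 0)
    (hV : ∀ k : ℤ, k < 0 → ∀ x, R < ‖x‖ → angCoef F k x = 0) :
    ∀ k : ℤ, k < 0 → ∀ x, angCoef F k x = 0 := by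
  have h1 := hF.directional (e1, 0)
  have h2 := hF.directional (e2, 0)
  set u : ℤ → R2 → ℂ := fun k x => fderiv ℝ (angCoef F k) x e1 + I * fderiv ℝ (angCoef F k) x e2
    with hu
  set v : ℤ → R2 → ℂ := fun k x => fderiv ℝ (angCoef F k) x e1 - I * fderiv ℝ (angCoef F k) x e2
    with hv
  have hzero : ∀ k : ℤ, k < 0 → ∀ x, R < ‖x‖ → fderiv ℝ (angCoef F k) x = 0 := by
    intro k hk x hx
    have : angCoef F k =ᶠ[𝓝 x] fun _ => 0 := by
      filter_upwards [(isOpen_lt continuous_const continuous_norm).mem_nhds hx] with y hy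
        using hV k hk y hy
    rw [this.fderiv_eq]
    simp
  have huv : ∀ k : ℤ, k < 0 → ∀ x, v k x = -u (k - 2) x := by
    intro k hk x
    by_cases hx : R < ‖x‖
    · simp [hu, hv, hzero k hk x hx, hzero (k - 2) (by omega) x hx]
    rw [eq_neg_iff_add_eq_zero]
    simp only [hu, hv, hF.fderiv_angCoef_e1, hF.fderiv_angCoef_e2]
    have hs1 : SmoothPeriodic fun p => -I * dirDeriv (e2, 0) F p := h2.const_mul _
    have hs2 : SmoothPeriodic fun p => I * dirDeriv (e2, 0) F p := h2.const_mul _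
    have hadd1 : SmoothPeriodic fun p => dirDeriv (e1, 0) F p +
        I * dirDeriv (e2, 0) F p := h1.add hs2
    have hadd2 : SmoothPeriodic fun p => dirDeriv (e1, 0) F p +
        -I * dirDeriv (e2, 0) F p := h1.add hs1
    have c1 := angCoef_add h1 hs2 (k - 2) x
    have c2 := angCoef_add h1 hs1 k x
    have c3 := angCoef_add hadd2 (hadd1.exp_mul 2) k x
    rw [angCoef_exp_mul, c1, c2, angCoef_const_mul, angCoef_const_mul] at c3
    have c4 : angCoef (fun p => (dirDeriv (e1, 0) F p + -I * dirDeriv (e2, 0) F p) +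
        Complex.exp ((2 : ℤ) * p.2 * I) * (dirDeriv (e1, 0) F p +
        I * dirDeriv (e2, 0) F p)) k x = 0 := by
      rw [angCoef]
      have : ∀ ψ : ℝ, (dirDeriv (e1, 0) F (x, ψ) + -I * dirDeriv (e2, 0) F (x, ψ)) +
        Complex.exp ((2 : ℤ) * ψ * I) * (dirDeriv (e1, 0) F (x, ψ) +
        I * dirDeriv (e2, 0) F (x, ψ)) = 0 := fun ψ => by
          have := hT x ψ (not_lt.mp hx)
          push_cast
          rw [← this]
          ring
      simp only [this]
      simp
    rw [c4] at c3
    rw [c3]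
    ring
  have hcs : ∀ k : ℤ, k < 0 → HasCompactSupport (angCoef F k) := by
    intro k hk
    refine HasCompactSupport.intro (isCompact_closedBall (0 : R2) R) fun x hx => hV k hk x ?_
    simpa using hx
  have hN : ∀ k : ℤ, k < 0 → ∫ x, ‖u k x‖ ^ 2 = ∫ x, ‖v k x‖ ^ 2 := fun k hk =>
    integral_sq_wirtinger (hF.contDiff_angCoef k) (hcs k hk)
  have hstep : ∀ k : ℤ, k < 0 → ∀ n : ℕ, ∫ x, ‖u k x‖ ^ 2 = ∫ x, ‖u (k - 2 * n) x‖ ^ 2 := by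
    intro k hk n
    induction n with
    | zero => simp
    | succ n ih =>
      rw [ih, hN _ (by omega)]
      simp only [huv (k - 2 * n) (by omega), norm_neg]
      congr! 5
      push_cast; ring
  obtain ⟨w1, hw1, hb1⟩ := h1.exists_summable_bound
  obtain ⟨w2, hw2, hb2⟩ := h2.exists_summable_bound
  have hub : ∀ k x, ‖u k x‖ ≤ w1 k + w2 k := by
    intro k x
    simp only [hu, hF.fderiv_angCoef_e1, hF.fderiv_angCoef_e2]
    refine (norm_add_le _ _).trans (add_le_add (hb1 k x) ?_)
    rw [norm_mul, Complex.norm_I, one_mul]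
    exact hb2 k x
  have huc : ∀ k, Continuous (u k) := fun k => by
    have := ((hF.contDiff_angCoef k).continuous_fderiv (by simp))
    exact (this.clm_apply continuous_const).add ((this.clm_apply continuous_const).const_mul I)
  have hvc : ∀ k, Continuous (v k) := fun k => by
    have := ((hF.contDiff_angCoef k).continuous_fderiv (by simp))
    exact (this.clm_apply continuous_const).sub ((this.clm_apply continuous_const).const_mul I)
  have hNle : ∀ k : ℤ, k < 0 → ∫ x, ‖u k x‖ ^ 2 ≤
      (w1 k + w2 k) ^ 2 * volume.real (Metric.closedBall (0 : R2) R) := by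
    intro k hk
    rw [← setIntegral_eq_integral_of_forall_compl_eq_zero (s := Metric.closedBall (0 : R2) R)]
    · refine (Real.le_norm_self _).trans (norm_setIntegral_le_of_norm_le_const ?_ ?_)
      · exact measure_closedBall_lt_top
      · intro x _
        rw [norm_pow, norm_norm]
        exact pow_le_pow_left₀ (norm_nonneg _) (hub k x) 2
    · intro x hx
      have hx' : R < ‖x‖ := by simpa using hx
      simp [hu, hzero k hk x hx']
  have hlim : Tendsto (fun k => (w1 k + w2 k) ^ 2 * volume.real (Metric.closedBall (0 : R2) R))
      cofinite (𝓝 0) := by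
    have := ((hw1.tendsto_cofinite_zero.add hw2.tendsto_cofinite_zero).pow 2).mul_const
      (volume.real (Metric.closedBall (0 : R2) R))
    simpa using this
  have hN0 : ∀ k : ℤ, k < 0 → ∫ x, ‖u k x‖ ^ 2 = 0 := by
    intro k hk
    have hinj : Function.Injective fun n : ℕ => k - 2 * n := fun a b h => by
      simp only at h; omega
    have hl := hlim.comp hinj.tendsto_cofinite
    rw [Nat.cofinite_eq_atTop] at hl
    refine le_antisymm (ge_of_tendsto' hl fun n => ?_) (integral_nonneg fun _ => by positivity)
    rw [hstep k hk n]
    exact hNle _ (by omega)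
  have hvanish : ∀ w : R2 → ℂ, Continuous w → (∀ x, R < ‖x‖ → w x = 0) →
      ∫ x, ‖w x‖ ^ 2 = 0 → ∀ x, w x = 0 := by
    intro w hw hws hw0 x
    by_contra hx
    have hc : Continuous fun x => ‖w x‖ ^ 2 := hw.norm.pow 2
    have hcs : HasCompactSupport fun x => ‖w x‖ ^ 2 :=
      HasCompactSupport.intro (isCompact_closedBall (0 : R2) R) fun x hx => by
        have hx' : R < ‖x‖ := by simpa using hx
        simp [hws x hx']
    refine (hc.integral_pos_of_hasCompactSupport_nonneg_nonzero (μ := volume) hcs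
      (fun _ => by positivity) (x := x) ?_).ne' hw0
    simpa using hx
  intro k hk
  have hu0 : ∀ x, u k x = 0 := hvanish _ (huc k)
    (fun x hx => by simp [hu, hzero k hk x hx]) (hN0 k hk)
  have hv0 : ∀ x, v k x = 0 := hvanish _ (hvc k)
    (fun x hx => by simp [hv, hzero k hk x hx]) (by rw [← hN k hk, hN0 k hk])
  have hd : ∀ x, fderiv ℝ (angCoef F k) x = 0 := by
    intro x
    have a1 := hu0 x
    have a2 := hv0 x
    simp only [hu, hv] at a1 a2
    have b1 : fderiv ℝ (angCoef F k) x e1 = 0 := by linear_combination (a1 + a2) / 2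
    have b2 : fderiv ℝ (angCoef F k) x e2 = 0 := by
      have : I * fderiv ℝ (angCoef F k) x e2 = 0 := by linear_combination (a1 - a2) / 2
      simpa using this
    rw [eq_planeCLM (fderiv ℝ (angCoef F k) x), b1, b2]
    ext v
    simp [planeCLM]
  intro x
  obtain ⟨y, hy⟩ := NormedSpace.exists_lt_norm ℝ R2 R
  rw [is_const_of_fderiv_eq_zero ((hF.contDiff_angCoef k).differentiable (by simp)) hd x y]
  exact hV k hk y hy

/-- Fourier inversion for a function without negative frequencies. -/
lemma angSeries_exp (hF : SmoothPeriodic F) {x : R2} (h : ∀ k : ℤ, k < 0 → angCoef F k x = 0)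
    (ψ : ℝ) : angSeries F (x, Complex.exp (ψ * I)) = F (x, ψ) := by
  have : Fact (0 < 2 * Real.pi) := ⟨Real.two_pi_pos⟩
  have hper : Function.Periodic (fun ψ => F (x, ψ)) (2 * Real.pi) := fun ψ => hF.periodic x ψ
  let f : C(AddCircle (2 * Real.pi), ℂ) :=
    ⟨hper.lift, (continuous_quot_lift _ (hF.continuous_slice x))⟩
  have hexp : ∀ (k : ℤ) (t : ℝ), fourier k (t : AddCircle (2 * Real.pi)) =
      Complex.exp (k * t * I) := by
    intro k t
    rw [fourier_coe_apply]
    congr 1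
    have : (Real.pi : ℂ) ≠ 0 := by exact_mod_cast Real.pi_ne_zero
    push_cast
    field_simp
  have hcoef : ∀ k, fourierCoeff f k = angCoef F k x := by
    intro k
    rw [fourierCoeff_eq_intervalIntegral f k 0, angCoef, zero_add]
    simp only [hexp]
    rw [Complex.real_smul]
    congr 1
    · push_cast; simp
    · refine intervalIntegral.integral_congr fun t _ => ?_
      have : f (t : AddCircle (2 * Real.pi)) = F (x, t) := hper.lift_coe t
      simp [this]
  have hs : Summable (fourierCoeff f) := by
    simp only [funext hcoef]
    exact (hF.summable_norm_angCoef x).of_norm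
  have hsum := has_pointwise_sum_fourier_series_of_summable hs (ψ : AddCircle (2 * Real.pi))
  have hval : f (ψ : AddCircle (2 * Real.pi)) = F (x, ψ) := hper.lift_coe ψ
  rw [hval, ← (Nat.cast_injective (R := ℤ)).hasSum_iff] at hsum
  · rw [← hsum.tsum_eq, angSeries]
    refine tsum_congr fun k => ?_
    simp only [Function.comp_apply, hcoef, hexp, smul_eq_mul, ← Complex.exp_nat_mul]
    congr 2
    push_cast; ring
  · intro k hk
    have hk' : k < 0 := by
      by_contra hk'
      exact hk ⟨k.toNat, by simpa using not_lt.mp hk'⟩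
    rw [hcoef, h k hk', zero_smul]

lemma exists_eq_exp {s : ℂ} (hs : ‖s‖ = 1) : ∃ ψ : ℝ, s = Complex.exp (ψ * I) := by
  obtain ⟨ψ, hψ⟩ := Complex.norm_eq_one_iff s |>.mp hs
  exact ⟨ψ, hψ.symm⟩

/-- Two functions analytic in the unit disc with equal boundary values coincide. -/
lemma eq_of_boundary {f g : ℂ → ℂ} (hf : DiffContOnCl ℂ f (Metric.ball 0 1))
    (hg : DiffContOnCl ℂ g (Metric.ball 0 1))
    (h : ∀ ψ : ℝ, f (Complex.exp (ψ * I)) = g (Complex.exp (ψ * I))) {s : ℂ} (hs : ‖s‖ ≤ 1) :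
    f s = g s := by
  refine Complex.eqOn_closure_of_eqOn_frontier Metric.isBounded_ball hf hg ?_ ?_
  · rw [frontier_ball _ one_ne_zero]
    intro z hz
    obtain ⟨ψ, rfl⟩ := exists_eq_exp (by simpa using hz)
    exact h ψ
  · rw [closure_ball _ one_ne_zero]
    simpa using hs

/-- The constancy of `F` along lines extends to a first order equation for its power series. -/
lemma angSeries_equation (hF : SmoothPeriodic F) (h : ∀ k : ℤ, k < 0 → ∀ x, angCoef F k x = 0)
    {x : R2} (hT : ∀ ψ,
      (dirDeriv (e1, 0) F (x, ψ) - I * dirDeriv (e2, 0) F (x, ψ)) + Complex.exp (2 * ψ * I) *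
        (dirDeriv (e1, 0) F (x, ψ) + I * dirDeriv (e2, 0) F (x, ψ)) = 0)
    {s : ℂ} (hs : ‖s‖ ≤ 1) :
    (angSeries (dirDeriv (e1, 0) F) (x, s) - I * angSeries (dirDeriv (e2, 0) F) (x, s))
      + s ^ 2 * (angSeries (dirDeriv (e1, 0) F) (x, s) +
        I * angSeries (dirDeriv (e2, 0) F) (x, s)) = 0 := by
  have h1 := hF.directional (e1, 0)
  have h2 := hF.directional (e2, 0)
  have hd : ∀ k : ℤ, k < 0 → fderiv ℝ (angCoef F k) x = 0 := by
    intro k hk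
    rw [show angCoef F k = fun _ => 0 from funext (h k hk)]
    simp
  have n1 : ∀ k : ℤ, k < 0 → angCoef (dirDeriv (e1, 0) F) k x = 0 := fun k hk => by
    rw [← hF.fderiv_angCoef_e1, hd k hk]; rfl
  have n2 : ∀ k : ℤ, k < 0 → angCoef (dirDeriv (e2, 0) F) k x = 0 := fun k hk => by
    rw [← hF.fderiv_angCoef_e2, hd k hk]; rfl
  have d1 := h1.diffContOnCl_angSeries x
  have d2 := h2.diffContOnCl_angSeries x
  have dI : DiffContOnCl ℂ (fun _ : ℂ => I) (Metric.ball 0 1) := diffContOnCl_const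
  have dsq : DiffContOnCl ℂ (fun s : ℂ => s ^ 2) (Metric.ball 0 1) :=
    (differentiable_id.pow 2).diffContOnCl
  refine eq_of_boundary (g := fun _ => 0)
    ((d1.sub (dI.smul d2)).add (dsq.smul (d1.add (dI.smul d2))))
    diffContOnCl_const (fun ψ => ?_) hs
  have := hT ψ
  simp only [Pi.add_apply, Pi.sub_apply, smul_eq_mul]
  rw [h1.angSeries_exp n1, h2.angSeries_exp n2, ← this, ← Complex.exp_nat_mul]
  push_cast
  ring_nf

end SmoothPeriodic


section Geometry

open RealInnerProductSpace

lemma inner_mk2 (x : R2) (a b : ℝ) : (⟪x, mk2 a b⟫ : ℝ) = x 0 * a + x 1 * b := by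
  simp [PiLp.inner_apply, mk2, Fin.sum_univ_two, mul_comm]

lemma norm_sq_eq (x : R2) : ‖x‖ ^ 2 = x 0 ^ 2 + x 1 ^ 2 := by
  simp [EuclideanSpace.real_norm_sq_eq, Fin.sum_univ_two]

/-- The point with coordinates `(a, b)` in the frame `(θ(φ), ν(φ))`. -/
def framePoint (a b φ : ℝ) : R2 :=
  mk2 (a * Real.cos φ - b * Real.sin φ) (a * Real.sin φ + b * Real.cos φ)

@[simp] lemma mk2_zero (a b : ℝ) : mk2 a b 0 = a := rfl
@[simp] lemma mk2_one (a b : ℝ) : mk2 a b 1 = b := rfl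

lemma inner_framePoint_dir (a b φ : ℝ) :
    (⟪framePoint a b φ, mk2 (Real.cos φ) (Real.sin φ)⟫ : ℝ) = a := by
  rw [inner_mk2, framePoint, mk2_zero, mk2_one]
  linear_combination a * Real.sin_sq_add_cos_sq φ

lemma inner_framePoint_normal (a b φ : ℝ) :
    (⟪framePoint a b φ, mk2 (-Real.sin φ) (Real.cos φ)⟫ : ℝ) = b := by
  rw [inner_mk2, framePoint, mk2_zero, mk2_one]
  linear_combination b * Real.sin_sq_add_cos_sq φ

lemma norm_framePoint_sq (a b φ : ℝ) : ‖framePoint a b φ‖ ^ 2 = a ^ 2 + b ^ 2 := by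
  rw [norm_sq_eq, framePoint, mk2_zero, mk2_one]
  linear_combination (a ^ 2 + b ^ 2) * Real.sin_sq_add_cos_sq φ

/-- The coordinate of `x` along the normal `ν(φ)`. -/
def normalCoord (x : R2) (φ : ℝ) : ℝ := x 0 * (-Real.sin φ) + x 1 * Real.cos φ

/-- The coordinate of `x` along the direction `θ(φ)`. -/
def tangentCoord (x : R2) (φ : ℝ) : ℝ := x 0 * Real.cos φ + x 1 * Real.sin φ

lemma tangentCoord_sq_add (x : R2) (φ : ℝ) :
    tangentCoord x φ ^ 2 + normalCoord x φ ^ 2 = ‖x‖ ^ 2 := by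
  rw [norm_sq_eq, tangentCoord, normalCoord]
  linear_combination (x 0 ^ 2 + x 1 ^ 2) * Real.sin_sq_add_cos_sq φ

/-- The end point, on the circle of radius `2R`, of the chord through `x` in the direction
`θ(φ)`. -/
def chordPoint (R : ℝ) (x : R2) (φ : ℝ) : R2 :=
  framePoint √((2 * R) ^ 2 - normalCoord x φ ^ 2) (normalCoord x φ) φ

lemma normalCoord_sq_lt {R : ℝ} {x : R2} (hx : ‖x‖ < 2 * R) (φ : ℝ) :
    0 < (2 * R) ^ 2 - normalCoord x φ ^ 2 := by
  have h := tangentCoord_sq_add x φ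
  have : ‖x‖ ^ 2 < (2 * R) ^ 2 := by gcongr
  nlinarith [sq_nonneg (tangentCoord x φ)]

lemma norm_chordPoint {R : ℝ} {x : R2} (hx : ‖x‖ < 2 * R) (φ : ℝ) :
    ‖chordPoint R x φ‖ = 2 * R := by
  have h0 : 0 ≤ 2 * R := (norm_nonneg x).trans hx.le
  rw [← sq_eq_sq₀ (norm_nonneg _) h0, chordPoint, norm_framePoint_sq,
    Real.sq_sqrt (normalCoord_sq_lt hx φ).le]
  ring

lemma chordPoint_add_smul (R : ℝ) (x : R2) (φ h : ℝ) :
    chordPoint R (x + h • mk2 (Real.cos φ) (Real.sin φ)) φ = chordPoint R x φ := by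
  have : normalCoord (x + h • mk2 (Real.cos φ) (Real.sin φ)) φ = normalCoord x φ := by
    simp [normalCoord]
    ring
  simp only [chordPoint, this]

lemma chordPoint_periodic (R : ℝ) (x : R2) (φ : ℝ) :
    chordPoint R x (φ - 2 * Real.pi) = chordPoint R x φ := by
  simp [chordPoint, framePoint, normalCoord]

lemma contDiffOn_chordPoint (R : ℝ) :
    ContDiffOn ℝ ∞ (fun p : R2 × ℝ => chordPoint R p.1 p.2) {p | ‖p.1‖ < 2 * R} := by
  have h0 : ContDiff ℝ ∞ fun p : R2 × ℝ => p.1 0 :=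
    (EuclideanSpace.proj (0 : Fin 2) : R2 →L[ℝ] ℝ).contDiff.comp contDiff_fst
  have h1 : ContDiff ℝ ∞ fun p : R2 × ℝ => p.1 1 :=
    (EuclideanSpace.proj (1 : Fin 2) : R2 →L[ℝ] ℝ).contDiff.comp contDiff_fst
  have hc : ContDiff ℝ ∞ fun p : R2 × ℝ => Real.cos p.2 := Real.contDiff_cos.comp contDiff_snd
  have hs : ContDiff ℝ ∞ fun p : R2 × ℝ => Real.sin p.2 := Real.contDiff_sin.comp contDiff_snd
  have hn : ContDiff ℝ ∞ fun p : R2 × ℝ => normalCoord p.1 p.2 :=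
    (h0.mul hs.neg).add (h1.mul hc)
  have hr : ContDiffOn ℝ ∞ (fun p : R2 × ℝ => √((2 * R) ^ 2 - normalCoord p.1 p.2 ^ 2))
      {p | ‖p.1‖ < 2 * R} :=
    (contDiff_const.sub (hn.pow 2)).contDiffOn.sqrt fun p hp => (normalCoord_sq_lt hp p.2).ne'
  rw [contDiffOn_euclidean]
  intro i
  fin_cases i
  · exact (hr.mul hc.contDiffOn).sub (hn.mul hs).contDiffOn
  · exact (hr.mul hs.contDiffOn).add (hn.mul hc).contDiffOn

/-- A function given in the annulus `R < |x| ≤ 2R`, equal at both ends of every chord of the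
annulus, is constant along the chords. -/
lemma eq_chordPoint {R : ℝ} {φ : ℝ} {q : R2 → ℂ}
    (h27 : ∀ x x' : R2, R < ‖x‖ → ‖x‖ ≤ 2 * R → R < ‖x'‖ → ‖x'‖ ≤ 2 * R →
      (⟪x, mk2 (-(Real.sin φ)) (Real.cos φ)⟫ : ℝ) =
        (⟪x', mk2 (-(Real.sin φ)) (Real.cos φ)⟫ : ℝ) →
      0 < (⟪x, mk2 (Real.cos φ) (Real.sin φ)⟫ : ℝ) →
      (⟪x', mk2 (Real.cos φ) (Real.sin φ)⟫ : ℝ) < 0 → q x = q x')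
    (hq : ContinuousOn q {x | ‖x‖ ≤ 2 * R}) {x : R2} (hx : R < ‖x‖) (hx2 : ‖x‖ < 2 * R) :
    q x = q (chordPoint R x φ) := by
  have hR : 0 < R := by linarith
  have main : ∀ y : R2, R < ‖y‖ → ‖y‖ < 2 * R → tangentCoord y φ ≠ 0 →
      q y = q (chordPoint R y φ) := by
    intro y hy hy2 hne
    have hpos := Real.sqrt_pos.mpr (normalCoord_sq_lt hy2 φ)
    have hn : ‖chordPoint R y φ‖ = 2 * R := norm_chordPoint hy2 φ
    rcases lt_or_gt_of_ne hne with h | h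
    · refine (h27 _ _ (by linarith) hn.le hy hy2.le ?_ ?_ ?_).symm
      · rw [chordPoint, inner_framePoint_normal, inner_mk2]; rfl
      · rw [chordPoint, inner_framePoint_dir]; exact hpos
      · rw [inner_mk2]; exact h
    · set z := framePoint (-√((2 * R) ^ 2 - normalCoord y φ ^ 2)) (normalCoord y φ) φ with hz
      have hnz : ‖z‖ = 2 * R := by
        rw [← hn, ← sq_eq_sq₀ (norm_nonneg _) (norm_nonneg _), chordPoint, hz,
          norm_framePoint_sq, norm_framePoint_sq, neg_sq]
      have hz0 : (⟪z, mk2 (Real.cos φ) (Real.sin φ)⟫ : ℝ) < 0 := by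
        rw [hz, inner_framePoint_dir]; linarith
      refine (h27 y z hy hy2.le (by linarith) hnz.le ?_ ?_ hz0).trans
        (h27 _ z (by linarith) hn.le (by linarith) hnz.le ?_ ?_ hz0).symm
      · rw [hz, inner_framePoint_normal, inner_mk2]; rfl
      · rw [inner_mk2]; exact h
      · rw [hz, chordPoint, inner_framePoint_normal, inner_framePoint_normal]
      · rw [chordPoint, inner_framePoint_dir]; exact hpos
  by_cases hne : tangentCoord x φ = 0
  swap
  · exact main x hx hx2 hne
  set θ : R2 := mk2 (Real.cos φ) (Real.sin φ) with hθ
  have hline : Tendsto (fun h : ℝ => x + h • θ) (𝓝[>] 0) (𝓝 x) := by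
    have : Continuous fun h : ℝ => x + h • θ := by fun_prop
    simpa using (this.tendsto 0).mono_left nhdsWithin_le_nhds
  have hcont : ContinuousAt q x :=
    hq.continuousAt (mem_of_superset
      ((isOpen_lt continuous_norm continuous_const).mem_nhds hx2) fun y (hy : ‖y‖ < 2 * R) => (le_of_lt hy : ‖y‖ ≤ 2 * R))
  refine tendsto_nhds_unique (hcont.tendsto.comp hline) (tendsto_const_nhds.congr' ?_)
  have e1 := hline.eventually ((isOpen_lt continuous_const continuous_norm).mem_nhds hx)
  have e2 := hline.eventually ((isOpen_lt continuous_norm continuous_const).mem_nhds hx2)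
  filter_upwards [e1, e2, self_mem_nhdsWithin] with h h1 h2 h3
  have ht : tangentCoord (x + h • θ) φ = h := by
    simp only [tangentCoord, PiLp.add_apply, PiLp.smul_apply, hθ, mk2_zero, mk2_one,
      smul_eq_mul] at hne ⊢
    linear_combination hne + h * Real.sin_sq_add_cos_sq φ
  rw [Function.comp_apply, main _ h1 h2 (by rw [ht]; exact (ne_of_gt h3)),
    hθ, chordPoint_add_smul]

end Geometry


section ScalarExtension

open RealInnerProductSpace

/-- A scalar function `q(x, t)`, smooth for `|x| ≤ 2R`, `|t| ≥ 1`, with the same value at both ends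
of every chord of the annulus `R < |x| ≤ 2R`, and whose restrictions `f x s = q x s⁻¹` over the
annulus are analytic in the unit disc. -/
structure ChordSymmetric (R : ℝ) (q f : R2 → ℂ → ℂ) : Prop where
  pos : 0 < R
  smooth : ContDiffOn ℝ ∞ (fun p : R2 × ℂ => q p.1 p.2) {p | ‖p.1‖ ≤ 2 * R ∧ 1 ≤ ‖p.2‖}
  chord : ∀ φ : ℝ, ∀ x x' : R2, R < ‖x‖ → ‖x‖ ≤ 2 * R → R < ‖x'‖ → ‖x'‖ ≤ 2 * R →
      (⟪x, mk2 (-(Real.sin φ)) (Real.cos φ)⟫ : ℝ) =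
        (⟪x', mk2 (-(Real.sin φ)) (Real.cos φ)⟫ : ℝ) →
      0 < (⟪x, mk2 (Real.cos φ) (Real.sin φ)⟫ : ℝ) →
      (⟪x', mk2 (Real.cos φ) (Real.sin φ)⟫ : ℝ) < 0 →
      q x (Complex.exp (I * φ)) = q x' (Complex.exp (I * φ))
  diffContOnCl : ∀ x, R < ‖x‖ → ‖x‖ ≤ 2 * R → DiffContOnCl ℂ (f x) (Metric.ball 0 1)
  eq_inv : ∀ x s, R < ‖x‖ → ‖x‖ ≤ 2 * R → s ≠ 0 → ‖s‖ ≤ 1 → f x s = q x s⁻¹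

/-- The value of `q` at the end of the chord through `x`, in the direction of angle `-ψ`. -/
def chordValue (R : ℝ) (q : R2 → ℂ → ℂ) (p : R2 × ℝ) : ℂ :=
  q (chordPoint R p.1 (-p.2)) (Complex.exp (I * ((-p.2 : ℝ) : ℂ)))

/-- `chordValue` cut off by a bump function. -/
def cutChordValue (R : ℝ) (q : R2 → ℂ → ℂ) (χ : ContDiffBump (0 : R2)) (p : R2 × ℝ) : ℂ :=
  (χ p.1 : ℂ) * chordValue R q p

/-- Functions with vanishing negative Fourier coefficients: boundary values of analytic ones. -/
lemma angCoef_eq_zero_of_diffContOnCl {F : R2 × ℝ → ℂ} {x : R2} {c : ℂ} {f : ℂ → ℂ}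
    (hf : DiffContOnCl ℂ f (Metric.ball 0 1))
    (hF : ∀ ψ : ℝ, F (x, ψ) = c * f (Complex.exp (ψ * I))) {k : ℤ} (hk : k < 0) :
    angCoef F k x = 0 := by
  obtain ⟨n, hn⟩ : ∃ n : ℕ, k = -(n + 1 : ℤ) := ⟨(-k - 1).toNat, by omega⟩
  have hd : DiffContOnCl ℂ (fun z => z ^ n • f z) (Metric.ball 0 1) :=
    ((differentiable_id.pow n).diffContOnCl).smul hf
  have h0 := hd.circleIntegral_eq_zero zero_le_one
  rw [circleIntegral] at h0
  have h1 : ∀ ψ : ℝ, Complex.exp (-(k * ψ * I)) * F (x, ψ) =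
      (c * (-I)) * (deriv (circleMap 0 1) ψ • (circleMap 0 1 ψ ^ n • f (circleMap 0 1 ψ))) := by
    intro ψ
    rw [hF, deriv_circleMap, circleMap]
    simp only [ofReal_one, one_mul, zero_add, smul_eq_mul]
    have : Complex.exp (-(k * ψ * I)) = Complex.exp (ψ * I) * Complex.exp (ψ * I) ^ n := by
      rw [← Complex.exp_nat_mul, ← Complex.exp_add, hn]
      congr 1
      push_cast; ring
    rw [this]
    linear_combination (c * Complex.exp (ψ * I) * Complex.exp (ψ * I) ^ n *
      f (Complex.exp (ψ * I))) * I_sq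
  simp only [angCoef, h1, intervalIntegral.integral_const_mul, h0, mul_zero]

namespace ChordSymmetric

variable {R : ℝ} {q f : R2 → ℂ → ℂ}

lemma contDiffOn_chordValue (h : ChordSymmetric R q f) :
    ContDiffOn ℝ ∞ (chordValue R q) {p | ‖p.1‖ < 2 * R} := by
  have hneg : ContDiff ℝ ∞ fun p : R2 × ℝ => (p.1, -p.2) := contDiff_fst.prodMk contDiff_snd.neg
  have hexp : ContDiff ℝ ∞ fun p : R2 × ℝ => Complex.exp (I * ((-p.2 : ℝ) : ℂ)) := by
    have : ContDiff ℝ ∞ fun p : R2 × ℝ => ((-p.2 : ℝ) : ℂ) :=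
      ofRealCLM.contDiff.comp contDiff_snd.neg
    fun_prop
  have hpair : ContDiffOn ℝ ∞ (fun p : R2 × ℝ => (chordPoint R p.1 (-p.2),
      Complex.exp (I * ((-p.2 : ℝ) : ℂ)))) {p | ‖p.1‖ < 2 * R} :=
    ((contDiffOn_chordPoint R).comp hneg.contDiffOn fun p hp => hp).prodMk hexp.contDiffOn
  refine ContDiffOn.comp (g := fun p : R2 × ℂ => q p.1 p.2) h.smooth hpair fun p hp =>
    ⟨(norm_chordPoint hp _).le, ?_⟩
  change 1 ≤ ‖Complex.exp (I * ((-p.2 : ℝ) : ℂ))‖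
  rw [mul_comm, Complex.norm_exp_ofReal_mul_I]

lemma eq_chordValue (h : ChordSymmetric R q f) {x : R2} (hx : R < ‖x‖) (hx2 : ‖x‖ < 2 * R)
    (ψ : ℝ) : chordValue R q (x, ψ) = f x (Complex.exp (ψ * I)) := by
  have hc : ContinuousOn (fun y => q y (Complex.exp (I * ((-ψ : ℝ) : ℂ)))) {x | ‖x‖ ≤ 2 * R} := by
    refine h.smooth.continuousOn.comp (f := fun y : R2 => (y, Complex.exp (I * ((-ψ : ℝ) : ℂ))))
      (by fun_prop) fun y hy => ⟨hy, ?_⟩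
    rw [mul_comm, Complex.norm_exp_ofReal_mul_I]
  rw [chordValue, ← eq_chordPoint (h.chord (-ψ)) hc hx hx2,
    h.eq_inv x _ hx hx2.le (Complex.exp_ne_zero _) (Complex.norm_exp_ofReal_mul_I ψ).le,
    ← Complex.exp_neg]
  congr 2
  push_cast; ring

lemma smoothPeriodic_cutChordValue (h : ChordSymmetric R q f) {χ : ContDiffBump (0 : R2)}
    (hχ : χ.rOut < 2 * R) : SmoothPeriodic (cutChordValue R q χ) where
  smooth := by
    rw [contDiff_iff_contDiffAt]
    intro p
    rcases lt_or_ge ‖p.1‖ (2 * R) with hp | hp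
    · have hχs : ContDiff ℝ ∞ fun p : R2 × ℝ => (χ p.1 : ℂ) :=
        ofRealCLM.contDiff.comp (χ.contDiff.comp contDiff_fst)
      have hop : IsOpen {p : R2 × ℝ | ‖p.1‖ < 2 * R} :=
        isOpen_lt (by fun_prop) continuous_const
      exact hχs.contDiffAt.mul (h.contDiffOn_chordValue.contDiffAt (hop.mem_nhds hp))
    · have : cutChordValue R q χ =ᶠ[𝓝 p] fun _ => 0 := by
        have hop : IsOpen {p : R2 × ℝ | χ.rOut < ‖p.1‖} :=
          isOpen_lt continuous_const (by fun_prop)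
        filter_upwards [hop.mem_nhds (hχ.trans_le hp)] with y (hy : χ.rOut < ‖y.1‖)
        simp [cutChordValue, χ.zero_of_le_dist (x := y.1) (by simpa using hy.le)]
      exact contDiffAt_const.congr_of_eventuallyEq this
  periodic x ψ := by
    have h1 : -(ψ + 2 * Real.pi) = -ψ - 2 * Real.pi := by ring
    have h2 : Complex.exp (I * ((-ψ - 2 * Real.pi : ℝ) : ℂ)) =
        Complex.exp (I * ((-ψ : ℝ) : ℂ)) := by
      rw [← Complex.exp_periodic (I * ((-ψ - 2 * Real.pi : ℝ) : ℂ))]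
      congr 1
      push_cast; ring
    simp only [cutChordValue, chordValue, h1, h2, chordPoint_periodic]
  support := ⟨χ.rOut, fun x ψ hx => by
    simp [cutChordValue, χ.zero_of_le_dist (x := x) (by simpa using hx.le)]⟩

lemma transport_cutChordValue (h : ChordSymmetric R q f) {χ : ContDiffBump (0 : R2)}
    (hχ : χ.rOut < 2 * R) {x : R2} (hx : ‖x‖ < χ.rIn) (ψ : ℝ) :
    (dirDeriv (e1, 0) (cutChordValue R q χ) (x, ψ) -
        I * dirDeriv (e2, 0) (cutChordValue R q χ) (x, ψ)) + Complex.exp (2 * ψ * I) *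
      (dirDeriv (e1, 0) (cutChordValue R q χ) (x, ψ) +
        I * dirDeriv (e2, 0) (cutChordValue R q χ) (x, ψ)) = 0 := by
  set F := cutChordValue R q χ
  have hF := h.smoothPeriodic_cutChordValue hχ
  set θ : R2 := mk2 (Real.cos (-ψ)) (Real.sin (-ψ)) with hθ
  have hline : HasDerivAt (fun r : ℝ => F (x + r • θ, ψ)) (fderiv ℝ F (x, ψ) (θ, 0)) 0 := by
    have hF' : HasFDerivAt F (fderiv ℝ F (x, ψ)) (x + (0 : ℝ) • θ, ψ) := by
      simpa using (hF.smooth.differentiable (by simp) (x, ψ)).hasFDerivAt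
    have hl : HasDerivAt (fun r : ℝ => (x + r • θ, ψ)) (θ, (0 : ℝ)) 0 := by
      simpa using (((hasDerivAt_id (0 : ℝ)).smul_const θ).const_add x).prodMk
        (hasDerivAt_const (0 : ℝ) ψ)
    exact hF'.comp_hasDerivAt 0 hl
  have hconst : (fun r : ℝ => F (x + r • θ, ψ)) =ᶠ[𝓝 0] fun _ => chordValue R q (x, ψ) := by
    have hc : Continuous fun r : ℝ => ‖x + r • θ‖ := by fun_prop
    filter_upwards [(isOpen_lt hc continuous_const).mem_nhds
      (show ‖x + (0 : ℝ) • θ‖ < χ.rIn by simpa using hx)] with r (hr : _ < _)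
    have h1 : χ (x + r • θ) = 1 := χ.one_of_mem_closedBall (by simpa using hr.le)
    simp only [F, cutChordValue, h1]
    simp only [chordValue, hθ, chordPoint_add_smul, ofReal_one, one_mul]
  have hzero : fderiv ℝ F (x, ψ) (θ, 0) = 0 :=
    hline.unique ((hasDerivAt_const _ _).congr_of_eventuallyEq hconst)
  have hdec : ((θ, 0) : R2 × ℝ) = Real.cos ψ • (e1, 0) - Real.sin ψ • (e2, 0) := by
    rw [SmoothPeriodic.eq_e1_add_e2 θ]
    simp [hθ, sub_eq_add_neg]
  rw [hdec, map_sub, map_smul, map_smul, Complex.real_smul, Complex.real_smul] at hzero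
  have hcs : Complex.exp (2 * ψ * I) = 2 * Complex.cos ψ * Complex.exp (ψ * I) - 1 := by
    rw [show 2 * (ψ : ℂ) * I = ψ * I + ψ * I by ring, Complex.exp_add, Complex.exp_mul_I]
    linear_combination -(Complex.sin_sq_add_cos_sq ψ) + Complex.sin ψ ^ 2 * I_sq
  have hsn : Complex.exp (2 * ψ * I) = 2 * I * Complex.sin ψ * Complex.exp (ψ * I) + 1 := by
    rw [show 2 * (ψ : ℂ) * I = ψ * I + ψ * I by ring, Complex.exp_add, Complex.exp_mul_I]
    linear_combination (Complex.sin_sq_add_cos_sq ψ) - Complex.sin ψ ^ 2 * I_sq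
  simp only [dirDeriv]
  push_cast at hzero
  linear_combination 2 * Complex.exp (ψ * I) * hzero + fderiv ℝ F (x, ψ) (e1, 0) * hcs +
    I * fderiv ℝ F (x, ψ) (e2, 0) * hsn +
    2 * Complex.exp (ψ * I) * Complex.sin ψ * fderiv ℝ F (x, ψ) (e2, 0) * I_sq

/-- The analytic extension in `t` over the whole disc, valid up to radius `ρ < 2R`. -/
theorem exists_extension (h : ChordSymmetric R q f) {ρ : ℝ} (hρ : R < ρ) (hρ2 : ρ < 2 * R) :
    ∃ G : R2 × ℂ → ℂ, ContDiffOn ℝ ∞ G planeDisc ∧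
      (∀ x, DiffContOnCl ℂ (fun s => G (x, s)) (Metric.ball 0 1)) ∧
      (∀ x s, R < ‖x‖ → ‖x‖ < ρ → ‖s‖ ≤ 1 → G (x, s) = f x s) ∧
      (∀ x (ψ : ℝ), ‖x‖ < ρ → G (x, Complex.exp (ψ * I)) = chordValue R q (x, ψ)) ∧
      (∀ x t, ‖x‖ < ρ → 1 ≤ ‖t‖ →
        zeta1 t * pdv e1 (fun y => G (y, t⁻¹)) x + zeta2 t * pdv e2 (fun y => G (y, t⁻¹)) x = 0) := by
  let χ : ContDiffBump (0 : R2) := ⟨ρ, (ρ + 2 * R) / 2, h.pos.trans hρ, by linarith⟩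
  have hχ : χ.rOut < 2 * R := by show (ρ + 2 * R) / 2 < 2 * R; linarith
  have hF := h.smoothPeriodic_cutChordValue hχ
  have hone : ∀ x ψ, ‖x‖ < ρ → cutChordValue R q χ (x, ψ) = chordValue R q (x, ψ) := by
    intro x ψ hx
    simp [cutChordValue, χ.one_of_mem_closedBall (x := x)
      (by simpa using (show ‖x‖ ≤ χ.rIn from hx.le))]
  have hneg : ∀ k : ℤ, k < 0 → ∀ x, angCoef (cutChordValue R q χ) k x = 0 := by
    refine hF.angCoef_eq_zero_of_neg (R := R)
      (fun x ψ hx => h.transport_cutChordValue hχ (hx.trans_lt hρ) ψ) fun k hk x hx => ?_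
    rcases lt_or_ge ‖x‖ (2 * R) with hx2 | hx2
    · exact angCoef_eq_zero_of_diffContOnCl (c := χ x) (h.diffContOnCl x hx hx2.le)
        (fun ψ => by rw [cutChordValue, h.eq_chordValue hx hx2]) hk
    · have : ∀ ψ, cutChordValue R q χ (x, ψ) = 0 := fun ψ => by
        simp [cutChordValue, χ.zero_of_le_dist (x := x) (by simpa using hχ.le.trans hx2)]
      simp [angCoef, this]
  have hbd : ∀ x (ψ : ℝ), ‖x‖ < ρ →
      angSeries (cutChordValue R q χ) (x, Complex.exp (ψ * I)) = chordValue R q (x, ψ) :=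
    fun x ψ hx => by rw [hF.angSeries_exp fun k hk => hneg k hk x, hone x ψ hx]
  refine ⟨angSeries (cutChordValue R q χ), hF.contDiffOn_angSeries, hF.diffContOnCl_angSeries,
    fun x s hx hx2 hs => ?_, hbd, fun x t hx ht => ?_⟩
  · exact SmoothPeriodic.eq_of_boundary (hF.diffContOnCl_angSeries x)
      (h.diffContOnCl x hx (hx2.trans hρ2).le)
      (fun ψ => by rw [hbd x ψ hx2, h.eq_chordValue hx (hx2.trans hρ2)]) hs
  · have ht0 : t ≠ 0 := norm_pos_iff.mp (one_pos.trans_le ht)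
    have hs : ‖t⁻¹‖ ≤ 1 := by rw [norm_inv]; exact inv_le_one_of_one_le₀ ht
    have e := hF.angSeries_equation hneg (h.transport_cutChordValue hχ hx) hs
    simp only [pdv, (hF.hasFDerivAt_angSeries_fst x hs).fderiv, SmoothPeriodic.planeCLM_e1,
      SmoothPeriodic.planeCLM_e2, zeta1, zeta2]
    rw [show (t - t⁻¹) / (2 * I) = -I * (t - t⁻¹) / 2 by
      field_simp
      linear_combination (t ^ 2 - 1) * I_sq]
    have ht1 : t * t⁻¹ = 1 := mul_inv_cancel₀ ht0
    generalize t⁻¹ = s at *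
    linear_combination (t / 2) * e - (s / 2) * (angSeries (dirDeriv (e1, 0)
      (cutChordValue R q χ)) (x, s) + I * angSeries (dirDeriv (e2, 0)
      (cutChordValue R q χ)) (x, s)) * ht1

end ChordSymmetric

end ScalarExtension


section SubringMatrix

variable {X : Type*} {m : ℕ} (S : Subring (X → ℂ)) {A B : X → Mat m}

lemma mul_entry_mem (hA : ∀ i j, (fun x => A x i j) ∈ S) (hB : ∀ i j, (fun x => B x i j) ∈ S)
    (i j : Fin m) : (fun x => (A x * B x) i j) ∈ S := by
  have : (fun x => (A x * B x) i j) = ∑ k, (fun x => A x i k) * fun x => B x k j := by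
    ext x
    simp [Matrix.mul_apply]
  rw [this]
  exact sum_mem fun k _ => mul_mem (hA i k) (hB k j)

/-- A matrix function with entries in a ring of functions is a matrix over this ring. -/
lemma exists_subring_matrix (hA : ∀ i j, (fun x => A x i j) ∈ S) :
    ∃ A' : Matrix (Fin m) (Fin m) S,
      ∀ x, A x = ((Pi.evalRingHom (fun _ : X => ℂ) x).comp S.subtype).mapMatrix A' :=
  ⟨Matrix.of fun i j => ⟨_, hA i j⟩, fun _ => rfl⟩

lemma det_mem (hA : ∀ i j, (fun x => A x i j) ∈ S) : (fun x => (A x).det) ∈ S := by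
  obtain ⟨A', hA'⟩ := exists_subring_matrix S hA
  have : (fun x => (A x).det) = (A'.det : X → ℂ) := by
    ext x
    rw [hA', ← RingHom.map_det]
    rfl
  rw [this]
  exact A'.det.2

lemma adjugate_entry_mem (hA : ∀ i j, (fun x => A x i j) ∈ S) (i j : Fin m) :
    (fun x => (A x).adjugate i j) ∈ S := by
  obtain ⟨A', hA'⟩ := exists_subring_matrix S hA
  have : (fun x => (A x).adjugate i j) = (A'.adjugate i j : X → ℂ) := by
    ext x
    rw [hA', ← RingHom.map_adjugate]
    rfl
  rw [this]
  exact (A'.adjugate i j).2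

lemma inv_mul_entry_mem (hA : ∀ i j, (fun x => A x i j) ∈ S) (hB : ∀ i j, (fun x => B x i j) ∈ S)
    (hinv : (fun x => (A x).det) ∈ S → (fun x => ((A x).det)⁻¹) ∈ S) (i j : Fin m) :
    (fun x => ((A x)⁻¹ * B x) i j) ∈ S := by
  refine mul_entry_mem S (fun i j => ?_) hB i j
  have : (fun x => (A x)⁻¹ i j) =
      (fun x => ((A x).det)⁻¹) * fun x => (A x).adjugate i j := by
    ext x
    simp [Matrix.inv_def, Ring.inverse_eq_inv']
  rw [this]
  exact mul_mem (hinv (det_mem S hA)) (adjugate_entry_mem S hA i j)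

/-- The ring of smooth functions on a set. -/
def contDiffOnSubring {E : Type*} [NormedAddCommGroup E] [NormedSpace ℝ E] (s : Set E) :
    Subring (E → ℂ) where
  carrier := {f | ContDiffOn ℝ ∞ f s}
  mul_mem' hf hg := ContDiffOn.mul hf hg
  one_mem' := contDiffOn_const
  add_mem' hf hg := ContDiffOn.add hf hg
  zero_mem' := contDiffOn_const
  neg_mem' hf := ContDiffOn.neg hf

/-- The disc algebra. -/
def discSubring : Subring (ℂ → ℂ) where
  carrier := {f | DiffContOnCl ℂ f (Metric.ball 0 1)}
  mul_mem' hf hg := DiffContOnCl.smul hf hg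
  one_mem' := diffContOnCl_const
  add_mem' hf hg := DiffContOnCl.add hf hg
  zero_mem' := diffContOnCl_const
  neg_mem' hf := DiffContOnCl.neg hf

end SubringMatrix

section Exterior

open RealInnerProductSpace

variable {m : ℕ} {R : ℝ}

/-- Smooth invertible matrix functions on `|x| ≤ 2R`, `|t| ≥ 1`, analytic in `t` up to `∞`. -/
structure ExteriorFamily (R : ℝ) (c : R2 → ℂ → Mat m) (cinf : R2 → Mat m) : Prop where
  smooth : ∀ i j, ContDiffOn ℝ ∞ (fun p : R2 × ℂ => c p.1 p.2 i j)
    {p : R2 × ℂ | ‖p.1‖ ≤ 2 * R ∧ 1 ≤ ‖p.2‖}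
  det_ne : ∀ (x : R2) (t : ℂ), ‖x‖ ≤ 2 * R → 1 ≤ ‖t‖ → (c x t).det ≠ 0
  analytic : ∀ x : R2, ‖x‖ ≤ 2 * R → ∀ i j,
    DifferentiableOn ℂ (fun t => c x t i j) {t : ℂ | 1 < ‖t‖} ∧
    AnalyticAt ℂ (fun s => extInf (c x) (cinf x) s i j) 0
  det_inf_ne : ∀ x : R2, ‖x‖ ≤ 2 * R → (cinf x).det ≠ 0

lemma one_lt_norm_inv {s : ℂ} (h0 : s ≠ 0) (hs : ‖s‖ < 1) : 1 < ‖s⁻¹‖ := by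
  rw [norm_inv]
  exact (one_lt_inv₀ (norm_pos_iff.mpr h0)).mpr hs

lemma one_le_norm_inv {s : ℂ} (h0 : s ≠ 0) (hs : ‖s‖ ≤ 1) : 1 ≤ ‖s⁻¹‖ := by
  rw [norm_inv]
  exact (one_le_inv₀ (norm_pos_iff.mpr h0)).mpr hs

lemma norm_inv_le_one {t : ℂ} (ht : 1 ≤ ‖t‖) : ‖t⁻¹‖ ≤ 1 := by
  rw [norm_inv]
  exact inv_le_one_of_one_le₀ ht

lemma extInf_of_ne {c : ℂ → Mat m} {L : Mat m} {s : ℂ} (hs : s ≠ 0) : extInf c L s = c s⁻¹ :=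
  if_neg hs

lemma extInf_zero (c : ℂ → Mat m) (L : Mat m) : extInf c L 0 = L := if_pos rfl

lemma extInf_eventuallyEq {c : ℂ → Mat m} {L : Mat m} {s : ℂ} (hs : s ≠ 0) :
    extInf c L =ᶠ[𝓝 s] fun z => c z⁻¹ := by
  filter_upwards [isOpen_ne.mem_nhds hs] with z hz using extInf_of_ne hz

namespace ExteriorFamily

variable {c : R2 → ℂ → Mat m} {cinf : R2 → Mat m}

lemma diffContOnCl_extInf (h : ExteriorFamily R c cinf) {x : R2} (hx : ‖x‖ ≤ 2 * R)
    (i j : Fin m) : DiffContOnCl ℂ (fun s => extInf (c x) (cinf x) s i j) (Metric.ball 0 1) := by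
  obtain ⟨hd, ha⟩ := h.analytic x hx i j
  refine ⟨fun s hs => ?_, fun s hs => ?_⟩
  · rcases eq_or_ne s 0 with rfl | h0
    · exact ha.differentiableAt.differentiableWithinAt
    · have hop : IsOpen {t : ℂ | 1 < ‖t‖} := isOpen_lt continuous_const continuous_norm
      have h1 : DifferentiableAt ℂ (fun t => c x t i j) s⁻¹ :=
        hd.differentiableAt (hop.mem_nhds (one_lt_norm_inv h0 (by simpa using hs)))
      have h2 : DifferentiableAt ℂ (fun z => c x z⁻¹ i j) s :=
        h1.comp s (differentiableAt_inv h0)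
      refine (h2.congr_of_eventuallyEq ?_).differentiableWithinAt
      filter_upwards [extInf_eventuallyEq (c := c x) (L := cinf x) h0] with z hz
      rw [hz]
  · rw [closure_ball _ one_ne_zero] at hs ⊢
    rcases eq_or_ne s 0 with rfl | h0
    · exact ha.continuousAt.continuousWithinAt
    · have h1 : ContinuousOn (fun z : ℂ => c x z⁻¹ i j) (Metric.closedBall 0 1 ∩ {0}ᶜ) := by
        refine ContinuousOn.comp (g := fun p : R2 × ℂ => c p.1 p.2 i j) (f := fun z => (x, z⁻¹))
          (h.smooth i j).continuousOn ?_ fun z hz =>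
            ⟨hx, one_le_norm_inv hz.2 (by simpa using hz.1)⟩
        exact continuousOn_const.prodMk (continuousOn_inv₀.mono fun z hz => hz.2)
      have h2 := (h1 s ⟨hs, h0⟩).mono_of_mem_nhdsWithin (s := Metric.closedBall 0 1)
        (inter_mem self_mem_nhdsWithin (mem_nhdsWithin_of_mem_nhds (isOpen_ne.mem_nhds h0)))
      refine h2.congr_of_eventuallyEq ?_ (by rw [extInf_of_ne h0])
      filter_upwards [mem_nhdsWithin_of_mem_nhds
        (extInf_eventuallyEq (c := c x) (L := cinf x) h0)] with z (hz : _ = _)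
      rw [hz]

lemma det_extInf_ne (h : ExteriorFamily R c cinf) {x : R2} (hx : ‖x‖ ≤ 2 * R) {s : ℂ}
    (hs : ‖s‖ ≤ 1) : (extInf (c x) (cinf x) s).det ≠ 0 := by
  rcases eq_or_ne s 0 with rfl | h0
  · rw [extInf_zero]
    exact h.det_inf_ne x hx
  · rw [extInf_of_ne h0]
    exact h.det_ne x _ hx (one_le_norm_inv h0 hs)

end ExteriorFamily

/-- The matrix function has the same value at both ends of every chord of the annulus. -/
def ChordInvariant (R : ℝ) (M : R2 → ℂ → Mat m) : Prop :=
  ∀ φ : ℝ, ∀ x x' : R2, R < ‖x‖ → ‖x‖ ≤ 2 * R → R < ‖x'‖ → ‖x'‖ ≤ 2 * R →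
    (⟪x, mk2 (-(Real.sin φ)) (Real.cos φ)⟫ : ℝ) =
      (⟪x', mk2 (-(Real.sin φ)) (Real.cos φ)⟫ : ℝ) →
    0 < (⟪x, mk2 (Real.cos φ) (Real.sin φ)⟫ : ℝ) →
    (⟪x', mk2 (Real.cos φ) (Real.sin φ)⟫ : ℝ) < 0 →
    M x (Complex.exp (I * φ)) = M x' (Complex.exp (I * φ))

/-- The ratio `(c₂)⁻¹ c₁`. -/
def ratio (c1 c2 : R2 → ℂ → Mat m) (x : R2) (t : ℂ) : Mat m := (c2 x t)⁻¹ * c1 x t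

/-- The ratio `(c₂)⁻¹ c₁` in the variable `s = 1 / t`, including `s = 0`. -/
def ratioInf (c1 c2 : R2 → ℂ → Mat m) (c1inf c2inf : R2 → Mat m) (x : R2) (s : ℂ) : Mat m :=
  (extInf (c2 x) (c2inf x) s)⁻¹ * extInf (c1 x) (c1inf x) s

variable {c1 c2 : R2 → ℂ → Mat m} {c1inf c2inf : R2 → Mat m}

lemma ratioInf_of_ne {x : R2} {s : ℂ} (hs : s ≠ 0) :
    ratioInf c1 c2 c1inf c2inf x s = ratio c1 c2 x s⁻¹ := by
  rw [ratioInf, extInf_of_ne hs, extInf_of_ne hs, ratio]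

lemma ratio_mul_ratio {x : R2} {t : ℂ} (h1 : (c1 x t).det ≠ 0) (h2 : (c2 x t).det ≠ 0) :
    ratio c1 c2 x t * ratio c2 c1 x t = 1 := by
  rw [ratio, ratio, Matrix.mul_assoc, Matrix.mul_nonsing_inv_cancel_left _ _ h1.isUnit,
    Matrix.nonsing_inv_mul _ h2.isUnit]

lemma ChordInvariant.swap (h1 : ExteriorFamily R c1 c1inf) (h2 : ExteriorFamily R c2 c2inf)
    (h : ChordInvariant R (ratio c1 c2)) : ChordInvariant R (ratio c2 c1) := by
  intro φ x x' hx hx2 hx' hx2' e1 e2 e3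
  have ht : 1 ≤ ‖Complex.exp (I * φ)‖ := by rw [mul_comm, Complex.norm_exp_ofReal_mul_I]
  have key : ∀ y : R2, ‖y‖ ≤ 2 * R → ratio c2 c1 y (Complex.exp (I * φ)) =
      (ratio c1 c2 y (Complex.exp (I * φ)))⁻¹ := fun y hy =>
    (Matrix.inv_eq_right_inv
      (ratio_mul_ratio (h1.det_ne y _ hy ht) (h2.det_ne y _ hy ht))).symm
  rw [key x hx2, key x' hx2', h φ x x' hx hx2 hx' hx2' e1 e2 e3]

lemma contDiffOn_ratio (h1 : ExteriorFamily R c1 c1inf) (h2 : ExteriorFamily R c2 c2inf)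
    (i j : Fin m) : ContDiffOn ℝ ∞ (fun p : R2 × ℂ => ratio c1 c2 p.1 p.2 i j)
      {p : R2 × ℂ | ‖p.1‖ ≤ 2 * R ∧ 1 ≤ ‖p.2‖} :=
  inv_mul_entry_mem (contDiffOnSubring _) h2.smooth h1.smooth
    (fun h => ContDiffOn.inv h fun p hp => h2.det_ne p.1 p.2 hp.1 hp.2) i j

lemma diffContOnCl_ratioInf (h1 : ExteriorFamily R c1 c1inf) (h2 : ExteriorFamily R c2 c2inf)
    {x : R2} (hx : ‖x‖ ≤ 2 * R) (i j : Fin m) :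
    DiffContOnCl ℂ (fun s => ratioInf c1 c2 c1inf c2inf x s i j) (Metric.ball 0 1) :=
  inv_mul_entry_mem discSubring (h2.diffContOnCl_extInf hx) (h1.diffContOnCl_extInf hx)
    (fun h => DiffContOnCl.inv h fun s hs => h2.det_extInf_ne hx
      (by rwa [closure_ball _ one_ne_zero, mem_closedBall_zero_iff] at hs)) i j

lemma chordSymmetric_ratio (hR : 0 < R) (h1 : ExteriorFamily R c1 c1inf)
    (h2 : ExteriorFamily R c2 c2inf) (h : ChordInvariant R (ratio c1 c2)) (i j : Fin m) :
    ChordSymmetric R (fun x t => ratio c1 c2 x t i j)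
      (fun x s => ratioInf c1 c2 c1inf c2inf x s i j) where
  pos := hR
  smooth := contDiffOn_ratio h1 h2 i j
  chord φ x x' hx hx2 hx' hx2' e1 e2 e3 := by rw [h φ x x' hx hx2 hx' hx2' e1 e2 e3]
  diffContOnCl x _ hx := diffContOnCl_ratioInf h1 h2 hx i j
  eq_inv x s _ _ hs _ := by rw [ratioInf_of_ne hs]

/-- The matrix extension of the ratio, in the variables `(x, s)` with `s = 1 / t`. -/
lemma exists_matrix_extension (hR : 0 < R) (h1 : ExteriorFamily R c1 c1inf)
    (h2 : ExteriorFamily R c2 c2inf) (h : ChordInvariant R (ratio c1 c2)) {ρ : ℝ} (hρ : R < ρ)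
    (hρ2 : ρ < 2 * R) :
    ∃ G : R2 → ℂ → Mat m,
      (∀ i j, ContDiffOn ℝ ∞ (fun p : R2 × ℂ => G p.1 p.2 i j) planeDisc) ∧
      (∀ x i j, DiffContOnCl ℂ (fun s => G x s i j) (Metric.ball 0 1)) ∧
      (∀ x s, R < ‖x‖ → ‖x‖ < ρ → ‖s‖ ≤ 1 → G x s = ratioInf c1 c2 c1inf c2inf x s) ∧
      (∀ x (ψ : ℝ), ‖x‖ < ρ → G x (Complex.exp (ψ * I)) =
        ratio c1 c2 (chordPoint R x (-ψ)) (Complex.exp (I * ((-ψ : ℝ) : ℂ)))) ∧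
      (∀ x t, ‖x‖ < ρ → 1 ≤ ‖t‖ → zDirM (zeta1 t) (zeta2 t) (fun y => G y t⁻¹) x = 0) := by
  choose G g1 g2 g3 g4 g5 using fun i j =>
    (chordSymmetric_ratio hR h1 h2 h i j).exists_extension hρ hρ2
  refine ⟨fun x s => Matrix.of fun i j => G i j (x, s), g1, fun x i j => g2 i j x, ?_, ?_, ?_⟩
  · intro x s hx hx2 hs
    ext i j
    exact g3 i j x s hx hx2 hs
  · intro x ψ hx
    ext i j
    exact g4 i j x ψ hx
  · intro x t hx ht
    ext i j
    exact g5 i j x t hx ht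

/-- The extensions of mutually inverse ratios are mutually inverse. -/
lemma det_extension_ne (h1 : ExteriorFamily R c1 c1inf) (h2 : ExteriorFamily R c2 c2inf)
    {G H : ℂ → Mat m} (hG : ∀ i j, DiffContOnCl ℂ (fun s => G s i j) (Metric.ball 0 1))
    (hH : ∀ i j, DiffContOnCl ℂ (fun s => H s i j) (Metric.ball 0 1))
    {y : ℝ → R2} {u : ℝ → ℂ} (hy : ∀ ψ, ‖y ψ‖ ≤ 2 * R) (hu : ∀ ψ, 1 ≤ ‖u ψ‖)
    (hG2 : ∀ ψ : ℝ, G (Complex.exp (ψ * I)) = ratio c1 c2 (y ψ) (u ψ))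
    (hH2 : ∀ ψ : ℝ, H (Complex.exp (ψ * I)) = ratio c2 c1 (y ψ) (u ψ))
    {s : ℂ} (hs : ‖s‖ ≤ 1) : (G s).det ≠ 0 := by
  have hGH : G s * H s = 1 := by
    ext i j
    refine SmoothPeriodic.eq_of_boundary (f := fun s => (G s * H s) i j)
      (g := fun _ => (1 : Mat m) i j) (mul_entry_mem discSubring hG hH i j)
      diffContOnCl_const (fun ψ => ?_) hs
    simp only [hG2, hH2,
      ratio_mul_ratio (h1.det_ne _ _ (hy ψ) (hu ψ)) (h2.det_ne _ _ (hy ψ) (hu ψ))]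
  intro h0
  simpa [h0] using congrArg Matrix.det hGH

/-- Analyticity in `t`, including `t = ∞`, of a function of `1 / t`. -/
lemma analytic_of_inv {Q : ℂ → Mat m} {L : Mat m} {g : ℂ → Mat m}
    (hg : ∀ i j, DiffContOnCl ℂ (fun s => g s i j) (Metric.ball 0 1))
    (hQ : ∀ t, 1 < ‖t‖ → Q t = g t⁻¹) (hL : L = g 0) (i j : Fin m) :
    DifferentiableOn ℂ (fun t => Q t i j) {t : ℂ | 1 < ‖t‖} ∧
      AnalyticAt ℂ (fun s => extInf Q L s i j) 0 := by
  constructor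
  · have h1 : DifferentiableOn ℂ (fun t => g t⁻¹ i j) {t : ℂ | 1 < ‖t‖} := by
      refine (hg i j).differentiableOn.comp (f := fun t : ℂ => t⁻¹)
        (differentiableOn_inv.mono fun t (ht : 1 < ‖t‖) =>
          norm_pos_iff.mp (one_pos.trans ht)) fun t (ht : 1 < ‖t‖) => ?_
      rw [mem_ball_zero_iff, norm_inv]
      exact inv_lt_one_of_one_lt₀ ht
    exact h1.congr fun t ht => by rw [hQ t ht]
  · have h1 : AnalyticAt ℂ (fun s => g s i j) 0 :=
      (hg i j).differentiableOn.analyticAt (Metric.ball_mem_nhds 0 one_pos)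
    refine h1.congr ?_
    filter_upwards [Metric.ball_mem_nhds (0 : ℂ) one_pos] with s hs
    rcases eq_or_ne s 0 with rfl | h0
    · rw [extInf_zero, hL]
    · rw [extInf_of_ne h0, hQ _ (one_lt_norm_inv h0 (by simpa using hs)), inv_inv]

lemma zDirM_congr {z1 z2 : ℂ} {c d : R2 → Mat m} {x : R2} (h : c =ᶠ[𝓝 x] d) :
    zDirM z1 z2 c x = zDirM z1 z2 d x := by
  ext i j
  have : (fun y => c y i j) =ᶠ[𝓝 x] fun y => d y i j := by
    filter_upwards [h] with y hy
    rw [hy]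
  simp only [zDirM, Matrix.of_apply, pdv, this.fderiv_eq]

/-- A function which jumps across the circle of radius `‖x‖` is not differentiable at `x`. -/
lemma fderiv_eq_zero_of_jump {f : R2 → ℂ} {x : R2}
    (h : ∀ r : ℝ, 1 < r → f (r • x) = f x + 1) : fderiv ℝ f x = 0 := by
  refine fderiv_zero_of_not_differentiableAt fun hd => ?_
  have hline : Tendsto (fun r : ℝ => r • x) (𝓝[>] 1) (𝓝 x) := by
    have : Continuous fun r : ℝ => r • x := by fun_prop
    simpa using (this.tendsto 1).mono_left nhdsWithin_le_nhds
  have h1 := hd.continuousAt.tendsto.comp hline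
  have h2 : Tendsto (f ∘ fun r : ℝ => r • x) (𝓝[>] 1) (𝓝 (f x + 1)) := by
    refine tendsto_const_nhds.congr' ?_
    filter_upwards [self_mem_nhdsWithin] with r hr
    exact (h r hr).symm
  simpa using tendsto_nhds_unique h1 h2

/-- The function `Q₊`: the extension inside, the ratio on the annulus; the values for `|x| > 2R`
only serve to make every entry discontinuous across the circle `|x| = 2R`. -/
def glued (R : ℝ) (G M : R2 → ℂ → Mat m) (x : R2) (t : ℂ) : Mat m :=
  if ‖x‖ ≤ R then G x t⁻¹ else if ‖x‖ ≤ 2 * R then M x t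
  else Matrix.of fun i j => M ((2 * R / ‖x‖) • x) t i j + 1

lemma glued_of_gt {G M : R2 → ℂ → Mat m} {x : R2} {t : ℂ} (hx : R < ‖x‖) (hx2 : ‖x‖ ≤ 2 * R) :
    glued R G M x t = M x t := by
  rw [glued, if_neg hx.not_ge, if_pos hx2]

lemma zDirM_glued_boundary (hR : 0 < R) {z1 z2 : ℂ} {G M : R2 → ℂ → Mat m} {x : R2} {t : ℂ}
    (hx : ‖x‖ = 2 * R) : zDirM z1 z2 (fun y => glued R G M y t) x = 0 := by
  ext i j
  have : fderiv ℝ (fun y => glued R G M y t i j) x = 0 := by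
    refine fderiv_eq_zero_of_jump fun r hr => ?_
    have hr0 : 0 < r := one_pos.trans hr
    have hn : ‖r • x‖ = r * (2 * R) := by rw [norm_smul, Real.norm_of_nonneg hr0.le, hx]
    have h2 : 2 * R < ‖r • x‖ := by rw [hn]; nlinarith
    have h3 : (2 * R / ‖r • x‖) • r • x = x := by
      rw [hn, smul_smul]
      have : 2 * R / (r * (2 * R)) * r = 1 := by field_simp
      rw [this, one_smul]
    rw [glued_of_gt (by linarith) hx.le, glued, if_neg (by linarith), if_neg h2.not_ge, h3,
      Matrix.of_apply]
  simp [zDirM, pdv, this]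

end Exterior

end

open RealInnerProductSpace in
/-- Lemma 2.2: extension of Q₊ = (c₊^{(2)})⁻¹c₊^{(1)} to closure(B_{2R})×closure(D⁺). -/
theorem lemma_Qplus (m : ℕ) (hm : 1 ≤ m) (R : ℝ) (hR : 0 < R)
    (A B : Fin 3 → R2 → Mat m)
    (hAsm : ∀ j, MatSmooth (A j)) (hBsm : ∀ j, MatSmooth (B j))
    (hAsupp : ∀ j, SuppIn (A j) R) (hBsupp : ∀ j, SuppIn (B j) R)
    (c1 c2 : R2 → ℂ → Mat m) (c1inf c2inf : R2 → Mat m)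
    -- c₊^{(i)} solve the respective equations on closure(B_{2R})×closure(D⁺)
    (heq1 : ∀ x : R2, ‖x‖ ≤ 2*R → ∀ t : ℂ, 1 ≤ ‖t‖ →
      zDirM (zeta1 t) (zeta2 t) (fun y => c1 y t) x =
        Acomb (A 0) (A 1) (A 2) (zeta1 t) (zeta2 t) x * c1 x t)
    (heq2 : ∀ x : R2, ‖x‖ ≤ 2*R → ∀ t : ℂ, 1 ≤ ‖t‖ →
      zDirM (zeta1 t) (zeta2 t) (fun y => c2 y t) x =
        Acomb (B 0) (B 1) (B 2) (zeta1 t) (zeta2 t) x * c2 x t)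
    -- smooth, invertible, analytic in t on D⁺ including t=∞
    (hsm1 : ∀ i j, ContDiffOn ℝ (⊤ : ℕ∞) (fun p : R2 × ℂ => c1 p.1 p.2 i j)
      {p : R2 × ℂ | ‖p.1‖ ≤ 2*R ∧ 1 ≤ ‖p.2‖})
    (hsm2 : ∀ i j, ContDiffOn ℝ (⊤ : ℕ∞) (fun p : R2 × ℂ => c2 p.1 p.2 i j)
      {p : R2 × ℂ | ‖p.1‖ ≤ 2*R ∧ 1 ≤ ‖p.2‖})
    (hdet1 : ∀ (x : R2) (t : ℂ), ‖x‖ ≤ 2*R → 1 ≤ ‖t‖ → (c1 x t).det ≠ 0)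
    (hdet2 : ∀ (x : R2) (t : ℂ), ‖x‖ ≤ 2*R → 1 ≤ ‖t‖ → (c2 x t).det ≠ 0)
    (han1 : ∀ x : R2, ‖x‖ ≤ 2*R → ∀ i j,
      DifferentiableOn ℂ (fun t => c1 x t i j) {t : ℂ | 1 < ‖t‖} ∧
      AnalyticAt ℂ (fun s => extInf (c1 x) (c1inf x) s i j) 0)
    (han2 : ∀ x : R2, ‖x‖ ≤ 2*R → ∀ i j,
      DifferentiableOn ℂ (fun t => c2 x t i j) {t : ℂ | 1 < ‖t‖} ∧
      AnalyticAt ℂ (fun s => extInf (c2 x) (c2inf x) s i j) 0)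
    (hdinf1 : ∀ x : R2, ‖x‖ ≤ 2*R → (c1inf x).det ≠ 0)
    (hdinf2 : ∀ x : R2, ‖x‖ ≤ 2*R → (c2inf x).det ≠ 0)
    -- hypothesis (2.7): equality of the boundary data at y₁ = +∞ and y₁ = −∞
    (h27 : ∀ φ : ℝ, ∀ x x' : R2,
      R < ‖x‖ → ‖x‖ ≤ 2*R → R < ‖x'‖ → ‖x'‖ ≤ 2*R →
      (⟪x, mk2 (-(Real.sin φ)) (Real.cos φ)⟫ : ℝ) =
        (⟪x', mk2 (-(Real.sin φ)) (Real.cos φ)⟫ : ℝ) →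
      0 < (⟪x, mk2 (Real.cos φ) (Real.sin φ)⟫ : ℝ) →
      (⟪x', mk2 (Real.cos φ) (Real.sin φ)⟫ : ℝ) < 0 →
      (c2 x (Complex.exp (Complex.I * φ)))⁻¹ * c1 x (Complex.exp (Complex.I * φ)) =
      (c2 x' (Complex.exp (Complex.I * φ)))⁻¹ * c1 x' (Complex.exp (Complex.I * φ))) :
    ∃ Q : R2 → ℂ → Mat m, ∃ Qinf : R2 → Mat m,
      -- Q₊ agrees with (c₊^{(2)})⁻¹c₊^{(1)} for R<|x|≤2R, |t|≥1
      (∀ (x : R2) (t : ℂ), R < ‖x‖ → ‖x‖ ≤ 2*R → 1 ≤ ‖t‖ →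
        Q x t = (c2 x t)⁻¹ * c1 x t) ∧
      -- (a₁) smoothness
      (∀ i j, ContDiffOn ℝ (⊤ : ℕ∞) (fun p : R2 × ℂ => Q p.1 p.2 i j)
        {p : R2 × ℂ | ‖p.1‖ ≤ 2*R ∧ 1 ≤ ‖p.2‖}) ∧
      -- (b₁) analyticity in t on D⁺ including t=∞
      (∀ x : R2, ‖x‖ ≤ 2*R → ∀ i j,
        DifferentiableOn ℂ (fun t => Q x t i j) {t : ℂ | 1 < ‖t‖} ∧
        AnalyticAt ℂ (fun s => extInf (Q x) (Qinf x) s i j) 0) ∧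
      -- (c₁) nonvanishing determinant, including at t=∞
      (∀ (x : R2) (t : ℂ), ‖x‖ ≤ 2*R → 1 ≤ ‖t‖ → (Q x t).det ≠ 0) ∧
      (∀ x : R2, ‖x‖ ≤ 2*R → (Qinf x).det ≠ 0) ∧
      -- (d₁) ζ(t)·∂Q₊/∂x = 0
      (∀ (x : R2) (t : ℂ), ‖x‖ ≤ 2*R → 1 ≤ ‖t‖ →
        zDirM (zeta1 t) (zeta2 t) (fun y => Q y t) x = 0) := by
  have E1 : ExteriorFamily R c1 c1inf := ⟨hsm1, hdet1, han1, hdinf1⟩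
  have E2 : ExteriorFamily R c2 c2inf := ⟨hsm2, hdet2, han2, hdinf2⟩
  have hM : ChordInvariant R (ratio c1 c2) := h27
  have hr1 : R < 3 * R / 2 := by linarith
  have hr2 : 3 * R / 2 < 2 * R := by linarith
  obtain ⟨G, gsm, gan, gout, gbd, geq⟩ := exists_matrix_extension hR E1 E2 hM hr1 hr2
  obtain ⟨H, -, han', -, hbd, -⟩ := exists_matrix_extension hR E2 E1 (hM.swap E1 E2) hr1 hr2
  have hball : ∀ s : ℂ, ‖s‖ ≤ 1 → ∀ x : R2, ‖x‖ < 3 * R / 2 → (G x s).det ≠ 0 := fun s hs x hx =>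
    det_extension_ne E1 E2 (gan x) (han' x)
      (fun ψ => (norm_chordPoint (hx.trans hr2) (-ψ)).le)
      (fun ψ => by rw [mul_comm, Complex.norm_exp_ofReal_mul_I])
      (fun ψ => gbd x ψ hx) (fun ψ => hbd x ψ hx) hs
  have hin : ∀ (x : R2) (t : ℂ), ‖x‖ < 3 * R / 2 → 1 ≤ ‖t‖ →
      glued R G (ratio c1 c2) x t = G x t⁻¹ := by
    intro x t hx ht
    rcases le_or_gt ‖x‖ R with h | h
    · rw [glued, if_pos h]
    · have ht0 : t⁻¹ ≠ 0 := inv_ne_zero (norm_pos_iff.mp (one_pos.trans_le ht))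
      rw [glued_of_gt h (hx.trans hr2).le, gout x _ h hx (norm_inv_le_one ht),
        ratioInf_of_ne ht0, inv_inv]
  have hout : ∀ (x : R2) (t : ℂ), R < ‖x‖ → ‖x‖ ≤ 2 * R →
      glued R G (ratio c1 c2) x t = ratio c1 c2 x t := fun x t hx hx2 => glued_of_gt hx hx2
  have hlt : ∀ r : ℝ, IsOpen {x : R2 | ‖x‖ < r} := fun r => isOpen_lt continuous_norm continuous_const
  have hgt : IsOpen {x : R2 | R < ‖x‖} := isOpen_lt continuous_const continuous_norm
  refine ⟨glued R G (ratio c1 c2),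
    fun x => if ‖x‖ ≤ R then G x 0 else ratioInf c1 c2 c1inf c2inf x 0,
    fun x t hx hx2 _ => hout x t hx hx2, fun i j => ?_, fun x hx => ?_, fun x t hx ht => ?_,
    fun x hx => ?_, fun x t hx ht => ?_⟩
  · rintro ⟨x, t⟩ ⟨hx, ht⟩
    rcases lt_or_ge ‖x‖ (3 * R / 2) with h | h
    · have hmap : ContDiffOn ℝ (⊤ : ℕ∞) (fun p : R2 × ℂ => (p.1, p.2⁻¹))
          {p : R2 × ℂ | ‖p.1‖ ≤ 2 * R ∧ 1 ≤ ‖p.2‖} :=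
        contDiffOn_fst.prodMk (contDiffOn_snd.inv fun p hp =>
          norm_pos_iff.mp (one_pos.trans_le hp.2))
      have hG : ContDiffOn ℝ (⊤ : ℕ∞) (fun p : R2 × ℂ => G p.1 p.2⁻¹ i j)
          {p : R2 × ℂ | ‖p.1‖ ≤ 2 * R ∧ 1 ≤ ‖p.2‖} :=
        ContDiffOn.comp (g := fun p : R2 × ℂ => G p.1 p.2 i j) (gsm i j) hmap fun p hp =>
          mem_planeDisc.mpr (norm_inv_le_one hp.2)
      refine (hG (x, t) ⟨hx, ht⟩).congr_of_eventuallyEq ?_ (by simp only [hin x t h ht])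
      filter_upwards [mem_nhdsWithin_of_mem_nhds
        (((hlt _).preimage continuous_fst).mem_nhds h), self_mem_nhdsWithin] with p hp hp2
      rw [hin p.1 p.2 hp hp2.2]
    · have h' : R < ‖x‖ := hr1.trans_le h
      refine (contDiffOn_ratio E1 E2 i j (x, t) ⟨hx, ht⟩).congr_of_eventuallyEq ?_
        (by simp only [hout x t h' hx])
      filter_upwards [mem_nhdsWithin_of_mem_nhds
        ((hgt.preimage continuous_fst).mem_nhds h'), self_mem_nhdsWithin] with p hp hp2
      rw [hout p.1 p.2 hp hp2.1]
  · by_cases h : ‖x‖ ≤ R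
    · exact analytic_of_inv (gan x) (fun t ht => hin x t (h.trans_lt hr1) ht.le) (if_pos h)
    · refine analytic_of_inv (diffContOnCl_ratioInf E1 E2 hx) (fun t ht => ?_) (if_neg h)
      rw [hout x t (not_le.mp h) hx,
        ratioInf_of_ne (inv_ne_zero (norm_pos_iff.mp (one_pos.trans ht))), inv_inv]
  · rcases lt_or_ge ‖x‖ (3 * R / 2) with h | h
    · rw [hin x t h ht]
      exact hball _ (norm_inv_le_one ht) x h
    · rw [hout x t (hr1.trans_le h) hx]
      exact Matrix.det_ne_zero_of_right_inverse
        (ratio_mul_ratio (E1.det_ne x t hx ht) (E2.det_ne x t hx ht))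
  · beta_reduce
    split_ifs with h
    · exact hball 0 (by simp) x (h.trans_lt hr1)
    · rw [ratioInf, extInf_zero, extInf_zero, Matrix.det_mul, Matrix.det_nonsing_inv,
        Ring.inverse_eq_inv']
      exact mul_ne_zero (inv_ne_zero (E2.det_inf_ne x hx)) (E1.det_inf_ne x hx)
  · rcases lt_or_ge ‖x‖ (3 * R / 2) with h | h
    · rw [← geq x t h ht]
      refine zDirM_congr ?_
      filter_upwards [(hlt _).mem_nhds h] with y hy using hin y t hy ht
    · have h' : R < ‖x‖ := hr1.trans_le h
      rcases hx.lt_or_eq with hx2 | hx2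
      · obtain ⟨ρ, hρ, hρ2⟩ := exists_between hx2
        obtain ⟨G', -, -, gout', -, geq'⟩ :=
          exists_matrix_extension hR E1 E2 hM (h'.trans hρ) hρ2
        rw [← geq' x t hρ ht]
        refine zDirM_congr ?_
        have ht0 : t⁻¹ ≠ 0 := inv_ne_zero (norm_pos_iff.mp (one_pos.trans_le ht))
        filter_upwards [hgt.mem_nhds h', (hlt _).mem_nhds hρ] with y hy1 hy2
        rw [hout y t hy1 (lt_trans hy2 hρ2).le, gout' y _ hy1 hy2 (norm_inv_le_one ht),
          ratioInf_of_ne ht0, inv_inv]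
      · exact zDirM_glued_boundary hR hx2
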